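/- arXiv:2401.04314 — 5 statements merged into one kernel-verified Lean document; each statement's English description precedes it below -/
import Mathlib

section
/- Let A be a commutative ring and f ∈ A⟦t⟧ a formal power series. Suppose there exist a natural number n and polynomials p, q ∈ A[t] with constant coefficient of q equal to 1, such that (image of q in A⟦t⟧) * t^n * f equals the image of p in A⟦t⟧. Then there exist polynomials p', q' ∈ A[t] with constant coefficient of q' equal to 1 such that (image of q' in A⟦t⟧) * f equals the image of p' in A⟦t⟧. (Equivalently, the square formed by A[t]_{1+tA[t]}, (A[t]_{1+tA[t]})[1/t], A⟦t⟧ and A((t)) is Cartesian.) -/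
/-- If `q * t^n * f` is a polynomial for some polynomial `q` with constant coefficient `1`,
then already `q' * f` is a polynomial for some polynomial `q'` with constant coefficient `1`
(Cartesianness of the square `A[t]_{1+tA[t]}, (A[t]_{1+tA[t]})[1/t], A⟦t⟧, A((t))`). -/
theorem powerSeries_algebraic_of_unit_mul (A : Type*) [CommRing A] (f : PowerSeries A)
    (n : ℕ) (p q : Polynomial A) (hq : q.coeff 0 = 1)
    (h : (q : PowerSeries A) * (PowerSeries.X : PowerSeries A) ^ n * f = (p : PowerSeries A)) :
    ∃ (p' q' : Polynomial A), q'.coeff 0 = 1 ∧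
      (q' : PowerSeries A) * f = (p' : PowerSeries A) := by
  have hp : (p : PowerSeries A) = PowerSeries.X ^ n * ((q : PowerSeries A) * f) := by rw [← h]; ring
  obtain ⟨r, rfl⟩ : Polynomial.X ^ n ∣ p := by
    refine Polynomial.X_pow_dvd_iff.2 fun d hd => ?_
    rw [← Polynomial.coeff_coe, hp, PowerSeries.coeff_X_pow_mul', if_neg hd.not_ge]
  refine ⟨r, q, hq, ?_⟩
  ext d
  rw [← PowerSeries.coeff_X_pow_mul _ n, ← hp, Polynomial.coeff_coe, Polynomial.coeff_coe,
    Polynomial.coeff_X_pow_mul]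
end

section
/- Let B be a commutative ring and B' a commutative B-algebra that is faithfully flat as a B-module. Let b₁, …, bₙ ∈ B⟦t⟧ be finitely many power series. If the images of b₁, …, bₙ under the coefficientwise map B⟦t⟧ → B'⟦t⟧ generate the unit ideal of B'⟦t⟧, then b₁, …, bₙ generate the unit ideal of B⟦t⟧. -/
/-- For a faithfully flat algebra `B → B'`, power series `b₁, …, bₙ ∈ B⟦t⟧` generate the
unit ideal of `B⟦t⟧` as soon as their images generate the unit ideal of `B'⟦t⟧`. -/
theorem powerSeries_span_top_of_faithfullyFlat (B B' : Type*) [CommRing B] [CommRing B']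
    [Algebra B B'] [Module.FaithfullyFlat B B'] (n : ℕ) (b : Fin n → PowerSeries B)
    (h : Ideal.span (Set.range fun i => PowerSeries.map (algebraMap B B') (b i)) = ⊤) :
    Ideal.span (Set.range b) = ⊤ := by
  set J := Ideal.span (Set.range b) with hJ
  have hmap : J.map (PowerSeries.map (algebraMap B B')) = ⊤ := by
    rw [hJ, Ideal.map_span, ← Set.range_comp]
    exact h
  have hcomp : (PowerSeries.constantCoeff (R := B')).comp (PowerSeries.map (algebraMap B B')) =
      (algebraMap B B').comp (PowerSeries.constantCoeff (R := B)) := by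
    ext f
    simp only [RingHom.comp_apply, ← PowerSeries.coeff_zero_eq_constantCoeff_apply,
      PowerSeries.coeff_map]
  have htop : (J.map (PowerSeries.constantCoeff (R := B))).map (algebraMap B B') = ⊤ := by
    rw [Ideal.map_map, ← hcomp, ← Ideal.map_map, hmap, Ideal.map_top]
  have hconst : J.map (PowerSeries.constantCoeff (R := B)) = ⊤ := by
    rw [← Ideal.comap_map_eq_self_of_faithfullyFlat (B := B') (J.map _), htop, Ideal.comap_top]
  have hone : (1 : B) ∈ J.map (PowerSeries.constantCoeff (R := B)) := by
    rw [hconst]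
    trivial
  obtain ⟨f, hf, hf1⟩ := (Ideal.mem_map_iff_of_surjective _
    PowerSeries.constantCoeff_surj).1 hone
  exact J.eq_top_of_isUnit_mem hf (PowerSeries.isUnit_iff_constantCoeff.2 (by simp [hf1]))
end

section
/- Let B be a commutative ring and B' a commutative B-algebra that is faithfully flat as a B-module. Let b₁, …, bₙ ∈ B⟦t⟧ be finitely many power series. If the images of b₁, …, bₙ in B'((t)) (under the composite B⟦t⟧ → B'⟦t⟧ → B'((t))) generate the unit ideal of B'((t)), then the images of b₁, …, bₙ in B((t)) generate the unit ideal of B((t)). -/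
open TensorProduct in
/-- A finite linear system over `B` that is solvable over a faithfully flat `B`-algebra is
solvable over `B`. -/
theorem mem_span_range_of_faithfullyFlat {B B' ι κ : Type*} [CommRing B] [CommRing B']
    [Algebra B B'] [Module.FaithfullyFlat B B'] [Fintype ι] [Fintype κ]
    (v : ι → κ → B) (y : κ → B) (c : ι → B')
    (h : ∀ k, ∑ i, c i * algebraMap B B' (v i k) = algebraMap B B' (y k)) :
    y ∈ Submodule.span B (Set.range v) := by
  classical
  set S := Submodule.span B (Set.range v)
  have expand (a : B') (w : κ → B) : a ⊗ₜ[B] S.mkQ w =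
      ∑ k, (a * algebraMap B B' (w k)) ⊗ₜ[B] S.mkQ (Pi.single k 1) := by
    have hw : w = ∑ k, w k • Pi.single k (1 : B) := by
      ext j
      simp [Finset.sum_apply, Pi.single_apply]
    conv_lhs => rw [hw, map_sum, tmul_sum]
    refine Finset.sum_congr rfl fun k _ => ?_
    rw [map_smul, ← smul_tmul, Algebra.smul_def, mul_comm]
  have key : (1 : B') ⊗ₜ[B] S.mkQ y = 0 := by
    rw [expand]
    simp only [one_mul, ← h, sum_tmul]
    rw [Finset.sum_comm]
    refine Finset.sum_eq_zero fun i _ => ?_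
    rw [← expand, S.mkQ_apply, (Submodule.Quotient.mk_eq_zero S).2
      (Submodule.subset_span ⟨i, rfl⟩), tmul_zero]
  have := Module.FaithfullyFlat.tensorProduct_mk_injective (A := B) (B := B') ((κ → B) ⧸ S)
  exact (Submodule.Quotient.mk_eq_zero S).1 (this (key.trans (by simp)))

namespace PowerSeries

theorem coeff_mul_eq_sum_fin {R : Type*} [CommRing R] {m M : ℕ} (hm : m < M) (f g : R⟦X⟧) :
    coeff m (f * g) = ∑ j : Fin M, coeff j g * coeff m (f * X ^ (j : ℕ)) := by
  rw [Fin.sum_univ_eq_sum_range (fun j => coeff j g * coeff m (f * X ^ j)), mul_comm f g,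
    coeff_mul, Finset.Nat.sum_antidiagonal_eq_sum_range_succ
      (fun i j => coeff i g * coeff j f)]
  refine Finset.sum_subset_zero_on_sdiff (Finset.range_mono hm) (fun j hj => ?_) fun j hj => ?_
  · simp only [Finset.mem_sdiff, Finset.mem_range] at hj
    rw [coeff_mul_X_pow', if_neg (by omega), mul_zero]
  · rw [coeff_mul_X_pow', if_pos (Nat.lt_succ_iff.1 (Finset.mem_range.1 hj))]

/-- A power series agreeing with `X ^ N` up to degree `N` is associated to `X ^ N`. -/
theorem associated_X_pow_of_coeff {R : Type*} [CommRing R] {N : ℕ} {f : R⟦X⟧}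
    (hf : ∀ m < N + 1, coeff m f = coeff m (X ^ N : R⟦X⟧)) : Associated (X ^ N) f := by
  obtain ⟨u, rfl⟩ : X ^ N ∣ f := X_pow_dvd_iff.2 fun m hm => by
    rw [hf m (by omega), coeff_X_pow, if_neg hm.ne]
  have hu : IsUnit u := by
    rw [isUnit_iff_constantCoeff, ← coeff_zero_eq_constantCoeff_apply]
    have := hf N (Nat.lt_succ_self N)
    rw [coeff_X_pow_mul', if_pos le_rfl, Nat.sub_self, coeff_X_pow_self] at this
    simp [this]
  exact ⟨hu.unit, rfl⟩

theorem span_range_localizationAway_X_eq_top_iff {R ι : Type*} [CommRing R] (b : ι → R⟦X⟧) :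
    Ideal.span (Set.range fun i => algebraMap R⟦X⟧ (Localization.Away (X : R⟦X⟧)) (b i)) = ⊤ ↔
      ∃ N : ℕ, X ^ N ∈ Ideal.span (Set.range b) := by
  have : (Set.range fun i => algebraMap R⟦X⟧ (Localization.Away (X : R⟦X⟧)) (b i)) =
      algebraMap R⟦X⟧ (Localization.Away (X : R⟦X⟧)) '' Set.range b := Set.range_comp _ b
  rw [this, ← Ideal.map_span,
    IsLocalization.map_algebraMap_ne_top_iff_disjoint (Submonoid.powers (X : R⟦X⟧)) _ _
      |>.not_right, Set.not_disjoint_iff]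
  simp [Submonoid.mem_powers_iff]

theorem exists_X_pow_mem_span_of_faithfullyFlat {B B' ι : Type*} [CommRing B] [CommRing B']
    [Algebra B B'] [Module.FaithfullyFlat B B'] [Fintype ι] (b : ι → B⟦X⟧) {N : ℕ}
    (h : X ^ N ∈ Ideal.span (Set.range fun i => map (algebraMap B B') (b i))) :
    X ^ N ∈ Ideal.span (Set.range b) := by
  obtain ⟨c, hc⟩ := Ideal.mem_span_range_iff_exists_fun.1 h
  have hy := mem_span_range_of_faithfullyFlat (B' := B')
    (fun (p : ι × Fin (N + 1)) (m : Fin (N + 1)) => coeff m (b p.1 * X ^ (p.2 : ℕ)))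
    (fun m => coeff m (X ^ N : B⟦X⟧)) (fun p => coeff p.2 (c p.1)) fun m => by
      rw [Fintype.sum_prod_type, ← coeff_map, map_pow, map_X, ← hc, map_sum]
      refine Finset.sum_congr rfl fun i _ => ?_
      rw [mul_comm (c i), coeff_mul_eq_sum_fin m.2]
      simp only [← coeff_map, map_mul, map_pow, map_X]
  obtain ⟨d, hd⟩ := (Submodule.mem_span_range_iff_exists_fun B).1 hy
  have hf : Associated (X ^ N) (∑ p, C (d p) * (b p.1 * X ^ (p.2 : ℕ))) :=
    associated_X_pow_of_coeff fun m hm => by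
      simpa using congrFun hd ⟨m, hm⟩
  refine Ideal.mem_of_dvd _ hf.symm.dvd (Ideal.sum_mem _ fun p _ => ?_)
  exact Ideal.mul_mem_left _ _ (Ideal.mul_mem_right _ _ (Ideal.subset_span ⟨p.1, rfl⟩))

end PowerSeries


/-- For a faithfully flat algebra `B → B'`, power series `b₁, …, bₙ ∈ B⟦t⟧` generate the
unit ideal of the Laurent series ring `B((t))` (realized as the localization of `B⟦t⟧`
away from `t`) as soon as their images generate the unit ideal of `B'((t))`. -/
theorem laurentSeries_span_top_of_faithfullyFlat (B B' : Type*) [CommRing B] [CommRing B']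
    [Algebra B B'] [Module.FaithfullyFlat B B'] (n : ℕ) (b : Fin n → PowerSeries B)
    (h : Ideal.span (Set.range fun i =>
        algebraMap (PowerSeries B') (Localization.Away (PowerSeries.X : PowerSeries B'))
          (PowerSeries.map (algebraMap B B') (b i))) = ⊤) :
    Ideal.span (Set.range fun i =>
        algebraMap (PowerSeries B) (Localization.Away (PowerSeries.X : PowerSeries B))
          (b i)) = ⊤ := by
  obtain ⟨N, hN⟩ := (PowerSeries.span_range_localizationAway_X_eq_top_iff _).1 h
  exact (PowerSeries.span_range_localizationAway_X_eq_top_iff b).2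
    ⟨N, PowerSeries.exists_X_pow_mem_span_of_faithfullyFlat b hN⟩
end

section
/- Let A be a commutative ring and n a natural number. Every invertible n × n matrix over the Laurent series ring A((t)) factors as a product of polynomial loops and positive loops: for every g ∈ GL_n(A((t))) there exist a ∈ GL_n(A[t, t⁻¹]) (invertible matrix over the Laurent polynomial ring) and b ∈ GL_n(A⟦t⟧) (invertible matrix over the power series ring) such that g is the product of the image of a and the image of b under the maps induced by the canonical ring homomorphisms A[t, t⁻¹] → A((t)) (sending t to t) and A⟦t⟧ → A((t)). Equivalently, GL_n(A((t))) = GL_n(A[t, t⁻¹]) · GL_n(A⟦t⟧). -/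
/-- The canonical ring homomorphism from Laurent polynomials `A[t, t⁻¹]` to Laurent series
`A((t))` (the localization of `A⟦t⟧` away from `t`), sending `t` to the image of `t`. -/
noncomputable def laurentInclusion (A : Type*) [CommRing A] :
    LaurentPolynomial A →+* Localization.Away (PowerSeries.X : PowerSeries A) :=
  haveI := LaurentPolynomial.isLocalization (R := A)
  IsLocalization.Away.lift (P := Localization.Away (PowerSeries.X : PowerSeries A))
    (Polynomial.X : Polynomial A)
    (g := (algebraMap (PowerSeries A) _).comp (Polynomial.coeToPowerSeries.ringHom))
    (by
      rw [RingHom.comp_apply]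
      simp only [Polynomial.coeToPowerSeries.ringHom_apply, Polynomial.coe_X]
      exact IsLocalization.Away.algebraMap_isUnit _)

namespace LaurentLoop

universe u

open scoped Matrix

section AwayLike

open Polynomial

variable {S S' : Type*} [CommRing S] [CommRing S'] {h : S →+* S'} {f : S}

/-- The element `f` becomes invertible along `h` and, up to powers of `f`, every element lifts
along `h` and every element of the kernel of `h` vanishes. -/
structure AwayLike (h : S →+* S') (f : S) : Prop where
  unit : IsUnit (h f)
  surj : ∀ x, ∀ᶠ N : ℕ in Filter.atTop, ∃ y, h y = h f ^ N * x
  inj : ∀ x, h x = 0 → ∀ᶠ N : ℕ in Filter.atTop, f ^ N * x = 0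

theorem awayLike_of_isLocalization [Algebra S S'] [IsLocalization.Away f S'] :
    AwayLike (algebraMap S S') f where
  unit := IsLocalization.Away.algebraMap_isUnit f
  surj x := by
    obtain ⟨N, y, hy⟩ := IsLocalization.Away.surj f x
    filter_upwards [Filter.eventually_ge_atTop N] with M hM
    obtain ⟨k, rfl⟩ := Nat.exists_eq_add_of_le' hM
    exact ⟨f ^ k * y, by rw [map_mul, map_pow, ← hy]; ring⟩
  inj x hx := by
    obtain ⟨⟨_, N, rfl⟩, hN⟩ := (IsLocalization.map_eq_zero_iff (Submonoid.powers f) S' x).mp hx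
    filter_upwards [Filter.eventually_ge_atTop N] with M hM
    obtain ⟨k, rfl⟩ := Nat.exists_eq_add_of_le' hM
    rw [pow_add, mul_assoc, hN, mul_zero]

theorem AwayLike.polynomial (H : AwayLike h f) : AwayLike (mapRingHom h) (C f) where
  unit := by simpa using H.unit.map C
  surj x := by
    induction x using Polynomial.induction_on' with
    | add p q hp hq =>
      filter_upwards [hp, hq] with N ⟨y, hy⟩ ⟨z, hz⟩
      exact ⟨y + z, by rw [map_add, hy, hz, mul_add]⟩
    | monomial n a =>
      filter_upwards [H.surj a] with N ⟨y, hy⟩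
      refine ⟨monomial n y, ?_⟩
      rw [coe_mapRingHom, map_monomial, map_C, ← C_pow, C_mul_monomial, hy]
  inj x hx := by
    have : ∀ᶠ N : ℕ in Filter.atTop, ∀ n ∈ x.support, f ^ N * x.coeff n = 0 :=
      (Filter.eventually_all_finset _).mpr fun n _ => H.inj _ (by
        simpa using congrArg (fun p => p.coeff n) hx)
    filter_upwards [this] with N hN
    ext n
    rw [← C_pow, coeff_C_mul, coeff_zero]
    by_cases hn : n ∈ x.support
    · exact hN n hn
    · rw [notMem_support_iff.mp hn, mul_zero]

theorem AwayLike.exists_map_eq_comp (H : AwayLike h f) {x : S'[X]} {r : S}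
    (hx : x.coeff 0 = h r) :
    ∀ᶠ N : ℕ in Filter.atTop, ∃ p : S[X], p.coeff 0 = r ∧
      p.map h = x.comp (C (h f ^ N) * X) := by
  filter_upwards [H.polynomial.surj x.divX] with N ⟨y, hy⟩
  refine ⟨X * y.comp (C (f ^ N) * X) + C r, by simp, ?_⟩
  have hy' : y.map h = C (h f ^ N) * x.divX := by simpa using hy
  conv_rhs => rw [← X_mul_divX_add x]
  simp only [Polynomial.map_add, Polynomial.map_mul, map_X, map_comp, map_C, map_pow, hy',
    add_comp, mul_comp, X_comp,
    C_comp, hx, Polynomial.map_pow, map_pow, pow_comp]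
  ring

theorem AwayLike.exists_matrix_map_eq (H : AwayLike h f) {n : ℕ}
    {F F' : Matrix (Fin n) (Fin n) S'[X]} (hF : F * F' = 1) (hF0 : F.map (eval 0) = 1) :
    ∀ᶠ N : ℕ in Filter.atTop, ∀ c : S, ∃ G G' : Matrix (Fin n) (Fin n) S,
      G * G' = 1 ∧ G.map h = F.map (eval (h (f ^ N * c))) := by
  have hF0' : F'.map (eval 0) = 1 := by
    have hF0 : F.map (evalRingHom 0) = 1 := hF0
    have : (F * F').map (evalRingHom 0) = 1 := by rw [hF]; simp
    rwa [Matrix.map_mul, hF0, one_mul] at this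
  have key : ∀ {F : Matrix (Fin n) (Fin n) S'[X]}, F.map (eval 0) = 1 →
      ∀ᶠ N : ℕ in Filter.atTop, ∃ P : Matrix (Fin n) (Fin n) S[X],
        P.map (evalRingHom 0) = 1 ∧
        P.map (mapRingHom h) = F.map (compRingHom (C (h f ^ N) * X)) := fun {F} hF => by
    have : ∀ᶠ N : ℕ in Filter.atTop, ∀ i j, ∃ p : S[X],
        p.coeff 0 = (1 : Matrix (Fin n) (Fin n) S) i j ∧
        p.map h = (F i j).comp (C (h f ^ N) * X) :=
      Filter.eventually_all.mpr fun i => Filter.eventually_all.mpr fun j =>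
        H.exists_map_eq_comp (by
          have := congrFun (congrFun hF i) j
          rw [Matrix.map_apply, ← coeff_zero_eq_eval_zero] at this
          rw [this]
          rw [Matrix.one_apply, Matrix.one_apply, apply_ite h, map_one, map_zero])
    filter_upwards [this] with N hN
    choose P hP hP' using hN
    refine ⟨Matrix.of P, ?_, ?_⟩
    · ext i j
      simp [← coeff_zero_eq_eval_zero, hP]
    · ext1 i j
      simp [hP']
  obtain ⟨N, ⟨P, hP0, hP⟩, ⟨P', hP0', hP'⟩⟩ := ((key hF0).and (key hF0')).exists
  have hker : (P * P' - 1).map (mapRingHom h) = 0 := by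
    rw [Matrix.map_sub _ (map_sub _), Matrix.map_mul, hP, hP', ← Matrix.map_mul, hF]
    simp
  have hconst : (P * P' - 1).map (evalRingHom 0) = 0 := by
    rw [Matrix.map_sub _ (map_sub _), Matrix.map_mul, hP0, hP0']
    simp
  have hkill : ∀ᶠ M : ℕ in Filter.atTop, ∀ i j, C f ^ M * ((P * P' - 1) i j).divX = 0 :=
    Filter.eventually_all.mpr fun i => Filter.eventually_all.mpr fun j => H.polynomial.inj _ (by
      have := congrFun (congrFun hker i) j
      ext k
      simpa [coeff_divX] using congrArg (fun p => p.coeff (k + 1)) this)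
  obtain ⟨M₀, hM₀⟩ := hkill.exists_forall_of_atTop
  filter_upwards [Filter.eventually_ge_atTop (M₀ + N)] with K hK c
  obtain ⟨M, rfl⟩ : ∃ M, K = M + N := ⟨K - N, by lia⟩
  refine ⟨P.map (evalRingHom (f ^ M * c)), P'.map (evalRingHom (f ^ M * c)), ?_, ?_⟩
  · rw [← Matrix.map_mul, ← sub_eq_zero]
    have : (P * P' - 1).map (evalRingHom (f ^ M * c)) = 0 := by
      ext i j
      have h1 := congrArg (eval (f ^ M * c)) (hM₀ M (by lia) i j)
      have h2 := congrFun (congrFun hconst i) j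
      rw [Matrix.map_apply, coe_evalRingHom, ← coeff_zero_eq_eval_zero] at h2
      rw [Matrix.map_apply, ← X_mul_divX_add ((P * P' - 1) i j), h2]
      simp only [eval_mul, eval_pow, eval_C, eval_zero] at h1
      simp only [Matrix.zero_apply, map_zero, add_zero, map_mul, coe_evalRingHom, eval_X]
      rw [mul_right_comm, h1, zero_mul]
    rwa [Matrix.map_sub _ (map_sub _), Matrix.map_one _ (map_zero _) (map_one _)] at this
  · ext i j
    have := congrArg (eval (h (f ^ M * c))) (congrFun (congrFun hP i) j)
    simp only [Matrix.map_apply, coe_mapRingHom, coe_compRingHom_apply, eval_comp,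
      eval_mul, eval_C, eval_X,
      eval_map] at this
    simp only [Matrix.map_apply, coe_evalRingHom]
    rw [← eval₂_hom, this]
    congr 1
    simp only [map_mul, map_pow]
    ring

end AwayLike

section Quillen

open Polynomial

variable {R S₁ S₂ D : Type*} [CommRing R] [CommRing S₁] [CommRing S₂] [CommRing D]

theorem exists_polynomial_factorization {j₁ : R →+* S₁} {j₂ : R →+* S₂} {k₁ : S₁ →+* D}
    {k₂ : S₂ →+* D} (hk : k₁.comp j₁ = k₂.comp j₂) {u u' : R} (hu : u + u' = 1)
    (H₁ : AwayLike k₁ (j₁ u')) (H₂ : AwayLike k₂ (j₂ u)) {n : ℕ}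
    {θ θ' : Matrix (Fin n) (Fin n) D[X]} (hθ : θ * θ' = 1) (hθ0 : θ.map (eval 0) = 1) :
    ∃ (α₁ α₁' : Matrix (Fin n) (Fin n) S₁[X]) (α₂ α₂' : Matrix (Fin n) (Fin n) S₂[X]),
      α₁ * α₁' = 1 ∧ α₂ * α₂' = 1 ∧
      θ = α₁.map (mapRingHom k₁) * α₂.map (mapRingHom k₂) := by
  have hθ' : θ' * θ = 1 := mul_eq_one_comm.mp hθ
  let σ : D[X] →+* D[X][X] := eval₂RingHom (C.comp C) (C X * X)
  let τ : D[X] →+* D[X][X] := eval₂RingHom (C.comp C) (C X * (1 - X))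
  have hσ0 : (evalRingHom 0).comp σ = C.comp (evalRingHom 0) := by
    ext <;> simp [σ]
  have hτ0 : (evalRingHom 0).comp τ = RingHom.id _ := by
    ext <;> simp [τ]
  have hmap : ∀ {A B E : Type _} [CommRing A] [CommRing B] [CommRing E] (f : A →+* B) (g : B →+* E)
      (M : Matrix (Fin n) (Fin n) A), (M.map f).map g = M.map (g.comp f) := fun f g M => by
    ext; simp
  have hone : ∀ {A B : Type _} [CommRing A] [CommRing B] (f : A →+* B),
      (1 : Matrix (Fin n) (Fin n) A).map f = 1 := fun f =>
    Matrix.map_one _ (map_zero _) (map_one _)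
  have hF₂ : θ.map σ * θ'.map σ = 1 := by rw [← Matrix.map_mul, hθ, hone]
  have hF₂0 : (θ.map σ).map (evalRingHom 0) = 1 := by
    have : θ.map (evalRingHom 0) = 1 := hθ0
    rw [hmap, hσ0, ← hmap, this, hone]
  have hF₁ : (θ.map C * θ'.map τ) * (θ.map τ * θ'.map C) = 1 := by
    rw [mul_assoc, ← mul_assoc (θ'.map τ), ← Matrix.map_mul, hθ', hone, one_mul,
      ← Matrix.map_mul, hθ, hone]
  have hF₁0 : (θ.map C * θ'.map τ).map (evalRingHom 0) = 1 := by
    have hC : (evalRingHom (0 : D[X])).comp C = RingHom.id _ := by ext <;> simp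
    rw [Matrix.map_mul, hmap, hmap, hτ0, hC]
    simpa using hθ
  obtain ⟨N, hN₁, hN₂⟩ := ((H₁.polynomial.exists_matrix_map_eq hF₁ hF₁0).and
    (H₂.polynomial.exists_matrix_map_eq hF₂ hF₂0)).exists
  obtain ⟨r, r', hr⟩ : IsCoprime (u ^ N) (u' ^ N) :=
    IsCoprime.pow ⟨1, 1, by rwa [one_mul, one_mul]⟩
  obtain ⟨G₁, G₁', hG₁, hG₁'⟩ := hN₁ (C (j₁ r'))
  obtain ⟨G₂, G₂', hG₂, hG₂'⟩ := hN₂ (C (j₂ r))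
  refine ⟨G₁, G₁', G₂, G₂', hG₁, hG₂, ?_⟩
  let w : D := k₂ (j₂ (u ^ N * r))
  have hw₂ : mapRingHom k₂ (C (j₂ u) ^ N * C (j₂ r)) = C w := by simp [w]
  have hw₁ : mapRingHom k₁ (C (j₁ u') ^ N * C (j₁ r')) = 1 - C w := by
    have : k₁ (j₁ (u' ^ N * r')) = k₂ (j₂ (u' ^ N * r')) := RingHom.congr_fun hk _
    have h2 : u' ^ N * r' = 1 - u ^ N * r := by linear_combination hr
    have h3 : mapRingHom k₁ (C (j₁ u') ^ N * C (j₁ r')) = C (k₁ (j₁ (u' ^ N * r'))) := by simp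
    rw [h3, this, h2]
    simp [w]
  have hcomp : (evalRingHom (1 - C w)).comp τ = (evalRingHom (C w)).comp σ := by
    ext <;> simp [σ, τ]
  have hC : (evalRingHom (1 - C w)).comp C = RingHom.id _ := by ext <;> simp
  rw [hG₁', hG₂', hw₁, hw₂, ← coe_evalRingHom, ← coe_evalRingHom, Matrix.map_mul, hmap, hmap, hmap,
    hcomp, hC, mul_assoc, ← Matrix.map_mul, hθ', hone]
  ext; simp

end Quillen

section LaurentSeries

open HahnSeries

section Basics

variable {R S T : Type*} [CommRing R] [CommRing S] [CommRing T]

theorem coeff_mul_eq_zero {x y : LaurentSeries R} {n : ℤ}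
    (h : ∀ i j, i + j = n → x.coeff i = 0 ∨ y.coeff j = 0) : (x * y).coeff n = 0 := by
  rw [HahnSeries.coeff_mul]
  refine Finset.sum_eq_zero fun ij hij => ?_
  rcases h ij.1 ij.2 (by simp_all) with h | h <;> simp [h]

theorem coeff_one_of_ne {n : ℤ} (hn : n ≠ 0) : (1 : LaurentSeries R).coeff n = 0 := by
  simp [HahnSeries.coeff_one, hn]

/-- The power series, as a subring of the Laurent series. -/
def pos (R : Type*) [CommRing R] : Subring (LaurentSeries R) where
  carrier := {x | ∀ n < 0, x.coeff n = 0}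
  mul_mem' {x y} hx hy n hn := coeff_mul_eq_zero fun i j hij => by
    rcases lt_or_ge i 0 with h | h
    · exact .inl (hx i h)
    · exact .inr (hy j (by lia))
  one_mem' n hn := coeff_one_of_ne hn.ne
  add_mem' {x y} hx hy n hn := by simp [hx n hn, hy n hn]
  zero_mem' n hn := by simp
  neg_mem' {x} hx n hn := by simp [hx n hn]

/-- The Laurent polynomials, as a subring of the Laurent series. -/
def fin (R : Type*) [CommRing R] : Subring (LaurentSeries R) where
  carrier := {x | ∃ m : ℤ, ∀ n > m, x.coeff n = 0}
  mul_mem' {x y} := by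
    rintro ⟨m, hx⟩ ⟨m', hy⟩
    refine ⟨m + m', fun n hn => coeff_mul_eq_zero fun i j hij => ?_⟩
    rcases lt_or_ge m i with h | h
    · exact .inl (hx i h)
    · exact .inr (hy j (by lia))
  one_mem' := ⟨0, fun n hn => coeff_one_of_ne hn.ne'⟩
  add_mem' {x y} := by
    rintro ⟨m, hx⟩ ⟨m', hy⟩
    exact ⟨max m m', fun n hn => by simp [hx n (by grind), hy n (by grind)]⟩
  zero_mem' := ⟨0, fun n hn => by simp⟩
  neg_mem' {x} := by
    rintro ⟨m, hx⟩
    exact ⟨m, fun n hn => by simp [hx n hn]⟩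

/-- The Laurent series all of whose terms have negative degree. -/
def neg (R : Type*) [CommRing R] : Submodule R (LaurentSeries R) where
  carrier := {x | ∀ n ≥ 0, x.coeff n = 0}
  add_mem' {x y} hx hy n hn := by simp [hx n hn, hy n hn]
  zero_mem' n hn := by simp
  smul_mem' c x hx n hn := by simp [hx n hn]

theorem mem_pos {x : LaurentSeries R} : x ∈ pos R ↔ ∀ n < 0, x.coeff n = 0 := Iff.rfl

theorem mem_fin {x : LaurentSeries R} : x ∈ fin R ↔ ∃ m : ℤ, ∀ n > m, x.coeff n = 0 := Iff.rfl

theorem neg_mul_mem {x y : LaurentSeries R} (hx : x ∈ neg R) (hy : y ∈ neg R) :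
    x * y ∈ neg R := fun n hn => coeff_mul_eq_zero fun i j hij => by
  rcases le_or_gt 0 i with h | h
  · exact .inl (hx i h)
  · exact .inr (hy j (by lia))

theorem neg_le_fin {x : LaurentSeries R} (hx : x ∈ neg R) : x ∈ fin R :=
  ⟨0, fun n hn => hx n (le_of_lt hn)⟩

theorem eq_zero_of_mem_pos_of_mem_neg {x : LaurentSeries R} (hx : x ∈ pos R) (hy : x ∈ neg R) :
    x = 0 := by
  ext n
  rcases lt_or_ge n 0 with h | h
  · exact hx n h
  · exact hy n h

theorem single_mem_fin (n : ℤ) (r : R) : (single n r : LaurentSeries R) ∈ fin R :=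
  ⟨n, fun _ hm => coeff_single_of_ne (ne_of_gt hm)⟩

theorem single_mem_pos {n : ℤ} (hn : 0 ≤ n) (r : R) : (single n r : LaurentSeries R) ∈ pos R :=
  fun m hm => coeff_single_of_ne (by lia)

theorem C_mem_fin (r : R) : (HahnSeries.C r : LaurentSeries R) ∈ fin R := single_mem_fin 0 r

theorem C_mem_pos (r : R) : (HahnSeries.C r : LaurentSeries R) ∈ pos R := single_mem_pos le_rfl r

/-- The sum of the terms of nonnegative degree. -/
noncomputable def posPart (x : LaurentSeries R) : LaurentSeries R :=
  ofPowerSeries ℤ R (PowerSeries.mk fun n => x.coeff n)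

theorem coeff_posPart (x : LaurentSeries R) (n : ℤ) :
    (posPart x).coeff n = if n < 0 then 0 else x.coeff n := by
  rw [posPart, PowerSeries.coeff_coe]
  split_ifs with h
  · rfl
  · simp [abs_of_nonneg (not_lt.mp h)]

theorem posPart_mem (x : LaurentSeries R) : posPart x ∈ pos R := fun n hn => by
  simp [coeff_posPart, hn]

theorem sub_posPart_mem (x : LaurentSeries R) : x - posPart x ∈ neg R := fun n hn => by
  simp [coeff_posPart, not_lt.mpr hn]

theorem mem_pos_iff_exists {x : LaurentSeries R} :
    x ∈ pos R ↔ ∃ p : PowerSeries R, ofPowerSeries ℤ R p = x := by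
  constructor
  · intro h
    refine ⟨PowerSeries.mk fun n => x.coeff n, ?_⟩
    change posPart x = x
    ext n
    rw [coeff_posPart]
    split_ifs with hn
    · exact (h n hn).symm
    · rfl
  · rintro ⟨p, rfl⟩ n hn
    rw [PowerSeries.coeff_coe, if_pos hn]

theorem exists_inv_of_mem_pos {x : LaurentSeries R} (hx : x ∈ pos R) (h : IsUnit (x.coeff 0)) :
    ∃ y ∈ pos R, x * y = 1 := by
  obtain ⟨p, rfl⟩ := mem_pos_iff_exists.mp hx
  have : IsUnit p := by
    rw [PowerSeries.isUnit_iff_constantCoeff]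
    simpa [PowerSeries.coeff_coe] using h
  obtain ⟨q, hq⟩ := this.exists_right_inv
  exact ⟨ofPowerSeries ℤ R q, mem_pos_iff_exists.mpr ⟨q, rfl⟩, by rw [← map_mul, hq, map_one]⟩

theorem coeff_zero_mul_of_mem_pos {x y : LaurentSeries R} (hx : x ∈ pos R) (hy : y ∈ pos R) :
    (x * y).coeff 0 = x.coeff 0 * y.coeff 0 := by
  obtain ⟨p, rfl⟩ := mem_pos_iff_exists.mp hx
  obtain ⟨q, rfl⟩ := mem_pos_iff_exists.mp hy
  rw [← map_mul, PowerSeries.coeff_coe, PowerSeries.coeff_coe, PowerSeries.coeff_coe]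
  simp

theorem exists_pole_bound (x : LaurentSeries R) : ∃ m : ℤ, ∀ n < m, x.coeff n = 0 :=
  ⟨x.order, fun _ hn => coeff_eq_zero_of_lt_order hn⟩

theorem eventually_pole_bound {ι κ : Type*} [Finite ι] [Finite κ]
    (M : ι → κ → LaurentSeries R) :
    ∀ᶠ K : ℕ in Filter.atTop, ∀ i j, ∀ n : ℤ, n < -K → (M i j).coeff n = 0 := by
  refine Filter.eventually_all.mpr fun i => Filter.eventually_all.mpr fun j => ?_
  obtain ⟨m, hm⟩ := exists_pole_bound (M i j)
  filter_upwards [Filter.eventually_ge_atTop m.natAbs] with K hK n hn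
  exact hm n (by lia)

theorem eventually_degree_bound {ι κ : Type*} [Finite ι] [Finite κ]
    {M : ι → κ → LaurentSeries R} (h : ∀ i j, M i j ∈ fin R) :
    ∀ᶠ K : ℕ in Filter.atTop, ∀ i j, ∀ n : ℤ, n > K → (M i j).coeff n = 0 := by
  refine Filter.eventually_all.mpr fun i => Filter.eventually_all.mpr fun j => ?_
  obtain ⟨m, hm⟩ := h i j
  filter_upwards [Filter.eventually_ge_atTop m.natAbs] with K hK n hn
  exact hm n (by lia)

/-- Apply a ring homomorphism to the coefficients of a Laurent series. -/
noncomputable def mapLS (f : R →+* S) : LaurentSeries R →+* LaurentSeries S where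
  toFun x := x.map f
  map_one' := by
    ext n
    by_cases h : n = 0 <;> simp [HahnSeries.coeff_one, h]
  map_mul' x y := HahnSeries.map_mul (f : R →ₙ+* S)
  map_zero' := by ext; simp
  map_add' x y := by ext; simp

@[simp]
theorem coeff_mapLS (f : R →+* S) (x : LaurentSeries R) (n : ℤ) :
    (mapLS f x).coeff n = f (x.coeff n) := rfl

theorem mapLS_comp (f : R →+* S) (g : S →+* T) : (mapLS g).comp (mapLS f) = mapLS (g.comp f) := by
  ext; simp

theorem mapLS_mem_pos (f : R →+* S) {x : LaurentSeries R} (hx : x ∈ pos R) :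
    mapLS f x ∈ pos S := fun n hn => by simp [hx n hn]

theorem mapLS_mem_fin (f : R →+* S) {x : LaurentSeries R} (hx : x ∈ fin R) :
    mapLS f x ∈ fin S := by
  obtain ⟨m, hm⟩ := hx
  exact ⟨m, fun n hn => by simp [hm n hn]⟩

@[simp]
theorem mapLS_single (f : R →+* S) (n : ℤ) (r : R) : mapLS f (single n r) = single n (f r) := by
  ext m
  by_cases h : m = n
  · subst h; simp
  · simp [coeff_single_of_ne h]

end Basics

section Matrices

variable {R S T : Type*} [CommRing R] [CommRing S] [CommRing T] {n : ℕ}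

/-- The general linear group of a subring, as a subgroup of the general linear group. -/
def glSub (n : ℕ) (A : Subring R) : Subgroup (GL (Fin n) R) :=
  (A.matrix : Subring (Matrix (Fin n) (Fin n) R)).toSubmonoid.units

theorem mem_glSub {A : Subring R} {g : GL (Fin n) R} :
    g ∈ glSub n A ↔ (∀ i j, g.val i j ∈ A) ∧ ∀ i j, g⁻¹.val i j ∈ A := Iff.rfl

theorem one_apply_mem (A : Subring R) (i j : Fin n) : (1 : Matrix (Fin n) (Fin n) R) i j ∈ A := by
  rw [Matrix.one_apply]
  split_ifs
  · exact one_mem _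
  · exact zero_mem _

theorem mul_apply_mem {A : Subring R} {M N : Matrix (Fin n) (Fin n) R}
    (hM : ∀ i j, M i j ∈ A) (hN : ∀ i j, N i j ∈ A) (i j : Fin n) : (M * N) i j ∈ A := by
  rw [Matrix.mul_apply]
  exact sum_mem fun k _ => mul_mem (hM i k) (hN k j)

theorem mem_glSub_of_mul_eq_one {A : Subring R} {M N : Matrix (Fin n) (Fin n) R}
    (hM : ∀ i j, M i j ∈ A) (hN : ∀ i j, N i j ∈ A) (h : M * N = 1) :
    (⟨M, N, h, mul_eq_one_comm.mp h⟩ : GL (Fin n) R) ∈ glSub n A := ⟨hM, hN⟩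

theorem det_mem {A : Subring R} {M : Matrix (Fin n) (Fin n) R} (hM : ∀ i j, M i j ∈ A) :
    M.det ∈ A := by
  rw [Matrix.det_apply]
  exact sum_mem fun σ _ => zsmul_mem (prod_mem fun i _ => hM _ _) _

theorem adjugate_mem {A : Subring R} {M : Matrix (Fin n) (Fin n) R} (hM : ∀ i j, M i j ∈ A)
    (i j : Fin n) : M.adjugate i j ∈ A := by
  rw [Matrix.adjugate_apply]
  refine det_mem fun k l => ?_
  rw [Matrix.updateRow_apply]
  split_ifs
  · rw [Pi.single_apply]
    split_ifs
    · exact one_mem _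
    · exact zero_mem _
  · exact hM _ _

theorem exists_mem_glSub_of_det {A : Subring R} {M : Matrix (Fin n) (Fin n) R}
    (hM : ∀ i j, M i j ∈ A) {d : R} (hd : d ∈ A) (h : M.det * d = 1) :
    ∃ g ∈ glSub n A, g.val = M := by
  have : M * (d • M.adjugate) = 1 := by
    rw [Matrix.mul_smul, Matrix.mul_adjugate, smul_smul, mul_comm, h, one_smul]
  exact ⟨_, mem_glSub_of_mul_eq_one hM
    (fun i j => A.mul_mem hd (adjugate_mem hM i j)) this, rfl⟩

theorem mem_glSub_of_det {A : Subring R} {g : GL (Fin n) R}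
    (hM : ∀ i j, g.val i j ∈ A) {d : R} (hd : d ∈ A) (h : g.val.det * d = 1) :
    g ∈ glSub n A := by
  obtain ⟨g', hg', h'⟩ := exists_mem_glSub_of_det hM hd h
  rwa [← Units.ext h']

/-- The map on general linear groups of Laurent series rings induced by a map of coefficients. -/
noncomputable def glMap (f : R →+* S) :
    GL (Fin n) (LaurentSeries R) →* GL (Fin n) (LaurentSeries S) :=
  Matrix.GeneralLinearGroup.map (mapLS f)

@[simp]
theorem glMap_apply (f : R →+* S) (g : GL (Fin n) (LaurentSeries R)) (i j : Fin n) :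
    (glMap f g).val i j = mapLS f (g.val i j) := rfl

@[simp]
theorem glMap_inv_apply (f : R →+* S) (g : GL (Fin n) (LaurentSeries R)) (i j : Fin n) :
    ((glMap f g)⁻¹).val i j = mapLS f (g⁻¹.val i j) := by
  rw [← map_inv]; rfl

theorem glMap_val (f : R →+* S) (g : GL (Fin n) (LaurentSeries R)) :
    (glMap f g).val = g.val.map (mapLS f) := rfl

theorem glMap_glMap (f : R →+* S) (h : S →+* T) (g : GL (Fin n) (LaurentSeries R)) :
    glMap h (glMap f g) = glMap (h.comp f) g := by
  ext; simp

theorem glMap_mem_fin (f : R →+* S) {g : GL (Fin n) (LaurentSeries R)} (hg : g ∈ glSub n (fin R)) :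
    glMap f g ∈ glSub n (fin S) :=
  ⟨fun i j => mapLS_mem_fin f (hg.1 i j), fun i j => by
    simpa using mapLS_mem_fin f (hg.2 i j)⟩

theorem glMap_mem_pos (f : R →+* S) {g : GL (Fin n) (LaurentSeries R)} (hg : g ∈ glSub n (pos R)) :
    glMap f g ∈ glSub n (pos S) :=
  ⟨fun i j => mapLS_mem_pos f (hg.1 i j), fun i j => by
    simpa using mapLS_mem_pos f (hg.2 i j)⟩

/-- An invertible matrix of Laurent series is the product of a polynomial and a positive loop. -/
def Factors (g : GL (Fin n) (LaurentSeries R)) : Prop :=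
  ∃ a ∈ glSub n (fin R), ∃ b ∈ glSub n (pos R), g = a * b

theorem Factors.map (f : R →+* S) {g : GL (Fin n) (LaurentSeries R)} (hg : Factors g) :
    Factors (glMap f g) := by
  obtain ⟨a, ha, b, hb, rfl⟩ := hg
  exact ⟨_, glMap_mem_fin f ha, _, glMap_mem_pos f hb, map_mul _ _ _⟩

theorem Factors.of_mul_left {a g : GL (Fin n) (LaurentSeries R)} (ha : a ∈ glSub n (fin R))
    (h : Factors (a * g)) : Factors g := by
  obtain ⟨a', ha', b, hb, h⟩ := h
  exact ⟨a⁻¹ * a', mul_mem (inv_mem ha) ha', b, hb, by rw [mul_assoc, ← h, inv_mul_cancel_left]⟩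

theorem Factors.of_mul_right {b g : GL (Fin n) (LaurentSeries R)} (hb : b ∈ glSub n (pos R))
    (h : Factors (g * b)) : Factors g := by
  obtain ⟨a, ha, b', hb', h⟩ := h
  exact ⟨a, ha, b' * b⁻¹, mul_mem hb' (inv_mem hb), by rw [← mul_assoc, ← h, mul_inv_cancel_right]⟩

end Matrices

section BigCell

variable {R : Type*} [CommRing R] {n : ℕ}

/-- The vectors `g b + v` with `b` a vector of power series and all terms of `v` of negative
degree. -/
noncomputable def latticeAddNeg (g : Matrix (Fin n) (Fin n) (LaurentSeries R)) :
    Submodule R (Fin n → LaurentSeries R) where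
  carrier := {w | ∃ b : Fin n → LaurentSeries R, (∀ i, b i ∈ pos R) ∧
    ∀ i, (w - g *ᵥ b) i ∈ neg R}
  add_mem' := by
    rintro w w' ⟨b, hb, h⟩ ⟨b', hb', h'⟩
    refine ⟨b + b', fun i => add_mem (hb i) (hb' i), fun i => ?_⟩
    rw [Matrix.mulVec_add, add_sub_add_comm]
    exact add_mem (h i) (h' i)
  zero_mem' := ⟨0, fun i => zero_mem _, fun i => by simp⟩
  smul_mem' := by
    rintro c w ⟨b, hb, h⟩
    refine ⟨c • b, fun i => ?_, fun i => ?_⟩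
    · rw [Pi.smul_apply, ← HahnSeries.C_mul_eq_smul]
      exact mul_mem (C_mem_pos c) (hb i)
    · have hC : ∀ x : Fin n → LaurentSeries R,
          c • x = (HahnSeries.C c : LaurentSeries R) • x := fun x =>
        funext fun i => by
          simp only [Pi.smul_apply, smul_eq_mul, HahnSeries.C_mul_eq_smul]
      rw [hC b, Matrix.mulVec_smul, ← hC, ← smul_sub]
      exact (neg R).smul_mem c (h i)

theorem mem_latticeAddNeg_of_coeff_eq_zero {g : GL (Fin n) (LaurentSeries R)} {K : ℕ}
    (hK : ∀ i j, ∀ m : ℤ, m < -K → (g⁻¹.val i j).coeff m = 0) {w : Fin n → LaurentSeries R}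
    (hw : ∀ i, ∀ m : ℤ, 0 ≤ m → m < K → (w i).coeff m = 0) :
    w ∈ latticeAddNeg g.val := by
  refine ⟨g⁻¹.val *ᵥ fun i => posPart (w i), fun i => ?_, fun i => ?_⟩
  · refine Subring.sum_mem (pos R) fun j _ => mem_pos.mpr fun m hm =>
      coeff_mul_eq_zero fun k l hkl => ?_
    rcases lt_or_ge k (-K) with h | h
    · exact .inl (hK i j k h)
    · right
      rw [coeff_posPart]
      split_ifs with hl
      · rfl
      · exact hw j l (by lia) (by lia)
  · rw [Matrix.mulVec_mulVec, ← Units.val_mul, mul_inv_cancel, Units.val_one, Matrix.one_mulVec]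
    exact sub_posPart_mem _

theorem exists_mul_sub_one_mem_neg {I : Ideal R} (hI : I ≤ Ideal.jacobson ⊥)
    (g : GL (Fin n) (LaurentSeries R))
    (hg : ∀ i j m, ((g.val - 1) i j).coeff m ∈ I) :
    ∃ b : Matrix (Fin n) (Fin n) (LaurentSeries R), (∀ i j, b i j ∈ pos R) ∧
      ∀ i j, (g.val * b - 1) i j ∈ neg R := by
  obtain ⟨K, hK⟩ := (eventually_pole_bound g⁻¹.val).exists
  let e : Fin n → Fin (K + 1) → (Fin n → LaurentSeries R) :=
    fun j k => Pi.single j (single (k : ℤ) 1)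
  let N : Submodule R (Fin n → LaurentSeries R) :=
    Submodule.span R (Set.range fun p : Fin n × Fin (K + 1) => e p.1 p.2)
  have he : ∀ j k, e j k ∈ N := fun j k => Submodule.subset_span ⟨(j, k), rfl⟩
  have key : ∀ w : Fin n → LaurentSeries R, (∀ i m, (w i).coeff m ∈ I) →
      w ∈ latticeAddNeg g.val ⊔ I • N := by
    intro w hw
    let s : Fin n → LaurentSeries R := ∑ j, ∑ k : Fin (K + 1), (w j).coeff k • e j k
    have hs : s ∈ I • N := sum_mem fun j _ => sum_mem fun k _ =>
      Submodule.smul_mem_smul (hw _ _) (he _ _)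
    have hsub : w - s ∈ latticeAddNeg g.val := by
      refine mem_latticeAddNeg_of_coeff_eq_zero hK fun i m h0 hm => ?_
      obtain ⟨m, rfl⟩ := Int.eq_ofNat_of_zero_le h0
      have : (s i).coeff (m : ℤ) = (w i).coeff m := by
        simp only [s, e, Finset.sum_apply, HahnSeries.coeff_sum, Pi.smul_apply,
          HahnSeries.coeff_smul]
        rw [Finset.sum_eq_single i, Finset.sum_eq_single ⟨m, by lia⟩]
        · simp
        · intro k _ hk
          have : (m : ℤ) ≠ k := fun h => hk (by ext; simpa using h.symm)
          simp [coeff_single_of_ne this]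
        · simp
        · intro j _ hj
          simp [Pi.single_eq_of_ne hj.symm]
        · simp
      simp [this]
    have := Submodule.add_mem_sup hsub hs
    rwa [sub_add_cancel] at this
  have hN : N ≤ latticeAddNeg g.val := by
    refine Submodule.le_of_le_smul_of_le_jacobson_bot
      (Submodule.fg_span (Set.finite_range _)) hI ?_
    rw [Submodule.span_le]
    rintro _ ⟨⟨j, k⟩, rfl⟩
    have h1 : g.val *ᵥ e j k ∈ latticeAddNeg g.val := by
      refine ⟨e j k, fun i => ?_, fun i => by simp⟩
      simp only [e, Pi.single_apply]
      split_ifs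
      · exact single_mem_pos (by simp) _
      · exact zero_mem _
    have h2 : (g.val - 1) *ᵥ e j k ∈ latticeAddNeg g.val ⊔ I • N := by
      refine key _ fun i m => ?_
      simp only [e, Matrix.mulVec_single, Matrix.col_apply, MulOpposite.smul_eq_mul_unop,
        Pi.smul_apply,
        MulOpposite.unop_op]
      rw [HahnSeries.coeff_mul_single]
      simpa using hg i j _
    have h3 : e j k = g.val *ᵥ e j k - (g.val - 1) *ᵥ e j k := by
      rw [Matrix.sub_mulVec, Matrix.one_mulVec, sub_sub_cancel]
    change e j k ∈ _
    rw [h3]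
    exact sub_mem (Submodule.mem_sup_left h1) h2
  have h0 : ∀ j, e j 0 ∈ latticeAddNeg g.val := fun j => hN (he j 0)
  choose b hb hbe using h0
  refine ⟨Matrix.of fun i j => b j i, fun i j => hb j i, fun i j => ?_⟩
  have := (neg R).neg_mem (hbe j i)
  rw [← Pi.neg_apply, neg_sub] at this
  convert! this using 1
  simp [e, Matrix.mul_apply, Matrix.mulVec, dotProduct, Matrix.one_apply, Pi.single_apply]

theorem factors_of_sub_one_mem_neg {g : GL (Fin n) (LaurentSeries R)}
    {b c : Matrix (Fin n) (Fin n) (LaurentSeries R)}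
    (hb : ∀ i j, b i j ∈ pos R) (hc : ∀ i j, c i j ∈ pos R)
    (hgb : ∀ i j, (g.val * b - 1) i j ∈ neg R) (hcg : ∀ i j, (c * g⁻¹.val - 1) i j ∈ neg R) :
    Factors g := by
  obtain ⟨v, hv⟩ : ∃ v, v = g.val * b - 1 := ⟨_, rfl⟩
  obtain ⟨u, hu⟩ : ∃ u, u = c * g⁻¹.val - 1 := ⟨_, rfl⟩
  have hcb : c * b - 1 = u + v + u * v := by
    have h1 : g.val * b = 1 + v := by rw [hv]; abel
    have h2 : c * g⁻¹.val = 1 + u := by rw [hu]; abel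
    have : (c * g⁻¹.val) * (g.val * b) = c * b := by
      rw [mul_assoc, ← mul_assoc g⁻¹.val, ← Units.val_mul, inv_mul_cancel, Units.val_one, one_mul]
    rw [← this, h1, h2, mul_add, mul_one, add_mul, one_mul]
    abel
  have hneg : ∀ i j, (u + v + u * v) i j ∈ neg R := fun i j => by
    subst hu hv
    exact add_mem (add_mem (hcg i j) (hgb i j)) (Submodule.sum_mem (neg R)
      fun k _ => neg_mul_mem (hcg i k) (hgb k j))
  have hcb1 : c * b = 1 := by
    rw [← sub_eq_zero]
    ext1 i j
    exact eq_zero_of_mem_pos_of_mem_neg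
      (sub_mem (mul_apply_mem hc hb i j) (one_apply_mem _ i j)) (hcb ▸ hneg i j)
  have hone : ∀ {w : Matrix (Fin n) (Fin n) (LaurentSeries R)}, (∀ i j, (w - 1) i j ∈ neg R) →
      ∀ i j, w i j ∈ fin R := fun {w} hw i j => by
    have : w i j = (w - 1) i j + (1 : Matrix (Fin n) (Fin n) (LaurentSeries R)) i j := by
      rw [Matrix.sub_apply, sub_add_cancel]
    rw [this]
    exact add_mem (neg_le_fin (hw i j)) (one_apply_mem _ i j)
  let β : GL (Fin n) (LaurentSeries R) := ⟨b, c, mul_eq_one_comm.mp hcb1, hcb1⟩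
  have hβ : β ∈ glSub n (pos R) := ⟨hb, hc⟩
  have hgβ : g * β ∈ glSub n (fin R) := by
    refine mem_glSub.mpr ⟨hone hgb, ?_⟩
    rw [mul_inv_rev]
    exact hone hcg
  exact ⟨g * β, hgβ, β⁻¹, inv_mem hβ, (mul_inv_cancel_right _ _).symm⟩

theorem factors_of_sub_one_coeff_mem {I : Ideal R} (hI : I ≤ Ideal.jacobson ⊥)
    (g : GL (Fin n) (LaurentSeries R))
    (hg : ∀ i j m, ((g.val - 1) i j).coeff m ∈ I)
    (hg' : ∀ i j m, ((g⁻¹.val - 1) i j).coeff m ∈ I) : Factors g := by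
  obtain ⟨b, hb, hgb⟩ := exists_mul_sub_one_mem_neg hI g hg
  let gt : GL (Fin n) (LaurentSeries R) :=
    ⟨g⁻¹.valᵀ, g.valᵀ, by rw [← Matrix.transpose_mul]; simp, by rw [← Matrix.transpose_mul]; simp⟩
  have hgt : gt.val - 1 = (g⁻¹.val - 1)ᵀ := by
    rw [Matrix.transpose_sub, Matrix.transpose_one]
  obtain ⟨c, hc, hgc⟩ := exists_mul_sub_one_mem_neg hI gt fun i j m => by
    rw [hgt]
    exact hg' j i m
  have hct : cᵀ * g⁻¹.val - 1 = (gt.val * c - 1)ᵀ := by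
    rw [Matrix.transpose_sub, Matrix.transpose_one, Matrix.transpose_mul]
    rfl
  refine factors_of_sub_one_mem_neg (c := cᵀ) hb (fun i j => hc j i) hgb fun i j => ?_
  rw [hct]
  exact hgc j i

end BigCell

section Local

variable {R k : Type*} [CommRing R] [Field k] {n : ℕ}

theorem exists_inv_mem_pos_of_field {h : GL (Fin n) (LaurentSeries k)}
    (hpos : ∀ i j, h.val i j ∈ pos k) (h0 : h.val.det.coeff 0 ≠ 0) : h ∈ glSub n (pos k) := by
  obtain ⟨d, hd, hd'⟩ := exists_inv_of_mem_pos (det_mem hpos) h0.isUnit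
  exact mem_glSub_of_det hpos hd hd'

theorem exists_ne_zero_vecMul_coeff_zero {M : Matrix (Fin n) (Fin n) (LaurentSeries k)}
    (hpos : ∀ i j, M i j ∈ pos k) (h0 : M.det.coeff 0 = 0) :
    ∃ v : Fin n → k, v ≠ 0 ∧ ∀ j, ∑ i, v i * (M i j).coeff 0 = 0 := by
  choose P hP using fun i j => mem_pos_iff_exists.mp (hpos i j)
  have hM : M = (Matrix.of P).map (ofPowerSeries ℤ k) := by ext1 i j; exact (hP i j).symm
  have hdet : ((Matrix.of P).map PowerSeries.constantCoeff).det = 0 := by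
    rw [← RingHom.mapMatrix_apply, ← RingHom.map_det]
    rw [hM, ← RingHom.mapMatrix_apply, ← RingHom.map_det, PowerSeries.coeff_coe] at h0
    simpa using h0
  obtain ⟨v, hv, hv'⟩ := Matrix.exists_vecMul_eq_zero_iff.mpr hdet
  refine ⟨v, hv, fun j => ?_⟩
  have := congrFun hv' j
  simpa [Matrix.vecMul, dotProduct, ← hP, PowerSeries.coeff_coe] using this

theorem det_updateRow_one {A : Type*} [CommRing A] (i : Fin n) (v : Fin n → A) :
    ((1 : Matrix (Fin n) (Fin n) A).updateRow i v).det = v i := by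
  rw [← Matrix.cramer_transpose_apply]
  simp

theorem updateRow_one_mul {A : Type*} [CommRing A] (i : Fin n) (v : Fin n → A)
    (M : Matrix (Fin n) (Fin n) A) :
    (1 : Matrix (Fin n) (Fin n) A).updateRow i v * M = M.updateRow i (v ᵥ* M) := by
  rw [Matrix.updateRow_mul, one_mul]

theorem exists_glMap_mul_mem_pos_of_coeff_det_ne_zero (π : R →+* k)
    (hπ : Function.Surjective π) (hunit : ∀ r, π r ≠ 0 → IsUnit r) (d : ℕ)
    (g : GL (Fin n) (LaurentSeries R)) (hpos : ∀ i j, (glMap π g).val i j ∈ pos k)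
    (hd : (glMap π g).val.det.coeff d ≠ 0) :
    ∃ a ∈ glSub n (fin R), glMap π (a * g) ∈ glSub n (pos k) := by
  induction d generalizing g with
  | zero =>
    exact ⟨1, one_mem _, by rw [one_mul]; exact exists_inv_mem_pos_of_field hpos hd⟩
  | succ d ih =>
    by_cases h0 : (glMap π g).val.det.coeff 0 = 0
    · obtain ⟨v, hv, hv'⟩ := exists_ne_zero_vecMul_coeff_zero hpos h0
      obtain ⟨i, hi⟩ := Function.ne_iff.mp hv
      choose w hw using fun j => hπ (v j)
      obtain ⟨u, hu⟩ := (hunit (w i) (by rw [hw]; exact hi)).exists_right_inv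
      let E := (1 : Matrix (Fin n) (Fin n) (LaurentSeries R)).updateRow i fun j => single (-1) (w j)
      have hE : ∀ j l, E j l ∈ fin R := fun j l => by
        simp only [E, Matrix.updateRow_apply]
        split_ifs
        · exact single_mem_fin _ _
        · exact one_apply_mem _ _ _
      obtain ⟨a, ha, haE⟩ := exists_mem_glSub_of_det (d := single 1 u) hE (single_mem_fin _ _) (by
        rw [det_updateRow_one, HahnSeries.single_mul_single, hu]; rfl)
      have hEπ : (glMap π a).val = (1 : Matrix (Fin n) (Fin n) (LaurentSeries k)).updateRow i
          fun j => single (-1) (v j) := by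
        rw [glMap_val, haE]
        ext1 j l
        simp only [E, Matrix.map_apply, Matrix.updateRow_apply, apply_ite (mapLS π), mapLS_single,
          hw, Matrix.one_apply, map_one, map_zero]
      have hmul : (glMap π (a * g)).val = (glMap π g).val.updateRow i
          ((fun j => single (-1) (v j)) ᵥ* (glMap π g).val) := by
        rw [map_mul, Units.val_mul, hEπ, updateRow_one_mul]
      have hpos' : ∀ j l, (glMap π (a * g)).val j l ∈ pos k := fun j l => by
        rw [hmul, Matrix.updateRow_apply]
        split_ifs
        · intro m hm
          simp only [Matrix.vecMul, dotProduct, HahnSeries.coeff_sum, HahnSeries.coeff_single_mul]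
          rcases lt_or_ge (m - -1) 0 with h | h
          · exact Finset.sum_eq_zero fun j _ => by rw [hpos j l _ h, mul_zero]
          · rw [show m - -1 = 0 by lia]
            exact hv' l
        · exact hpos j l
      have hdet : (glMap π (a * g)).val.det.coeff d ≠ 0 := by
        rw [map_mul, Units.val_mul, Matrix.det_mul, hEπ, det_updateRow_one,
          HahnSeries.coeff_single_mul, sub_neg_eq_add]
        exact mul_ne_zero hi (by simpa using hd)
      obtain ⟨a', ha', h⟩ := ih (a * g) hpos' hdet
      exact ⟨a' * a, mul_mem ha' ha, by rwa [mul_assoc]⟩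
    · exact ⟨1, one_mem _, by rw [one_mul]; exact exists_inv_mem_pos_of_field hpos h0⟩

theorem exists_mem_fin_eq_smul_one (A : Type*) [CommRing A] (n : ℕ) (K : ℤ) :
    ∃ a ∈ glSub n (fin A),
      a.val = (single K (1 : A) : LaurentSeries A) • (1 : Matrix (Fin n) (Fin n) _) := by
  have h : ∀ K i j, ((single K (1 : A) : LaurentSeries A) •
      (1 : Matrix (Fin n) (Fin n) (LaurentSeries A))) i j ∈ fin A := fun K i j => by
    rw [Matrix.smul_apply, smul_eq_mul]
    exact mul_mem (single_mem_fin _ _) (one_apply_mem _ _ _)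
  refine ⟨_, mem_glSub_of_mul_eq_one (h K) (h (-K)) ?_, rfl⟩
  rw [smul_mul_smul_comm, HahnSeries.single_mul_single]
  simp

theorem exists_glMap_mul_mem_pos (π : R →+* k)
    (hπ : Function.Surjective π) (hunit : ∀ r, π r ≠ 0 → IsUnit r)
    (g : GL (Fin n) (LaurentSeries R)) :
    ∃ a ∈ glSub n (fin R), glMap π (a * g) ∈ glSub n (pos k) := by
  obtain ⟨K, hK⟩ := (eventually_pole_bound g.val).exists
  obtain ⟨a, ha, haK⟩ := exists_mem_fin_eq_smul_one R n K
  have hpos : ∀ i j, (glMap π (a * g)).val i j ∈ pos k := fun i j => by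
    rw [glMap_apply, Units.val_mul, haK, Matrix.smul_mul, one_mul]
    refine mapLS_mem_pos π fun m hm => ?_
    rw [Matrix.smul_apply, smul_eq_mul, HahnSeries.coeff_single_mul, hK i j _ (by lia), mul_zero]
  have hdet : (glMap π (a * g)).val.det ≠ 0 :=
    ((Matrix.isUnit_iff_isUnit_det _).mp (glMap π (a * g)).isUnit).ne_zero
  obtain ⟨m, hm⟩ : ∃ m, (glMap π (a * g)).val.det.coeff m ≠ 0 := by
    by_contra! h
    exact hdet (by ext m; exact h m)
  obtain ⟨d, rfl⟩ : ∃ d : ℕ, m = d := Int.eq_ofNat_of_zero_le (by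
    by_contra! h
    exact hm (det_mem hpos m h))
  obtain ⟨a', ha', h⟩ := exists_glMap_mul_mem_pos_of_coeff_det_ne_zero π hπ hunit d (a * g) hpos hm
  exact ⟨a' * a, mul_mem ha' ha, by rwa [mul_assoc]⟩

theorem exists_mem_pos_glMap_eq {R S : Type*} [CommRing R] [CommRing S] (π : R →+* S)
    (hunit : ∀ r, IsUnit (π r) → IsUnit r) {g : GL (Fin n) (LaurentSeries R)}
    (hg : glMap π g ∈ glSub n (pos S)) :
    ∃ b ∈ glSub n (pos R), glMap π b = glMap π g := by
  let M := g.val.map posPart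
  have hM : ∀ i j, M i j ∈ pos R := fun i j => posPart_mem _
  have hMπ : M.map (mapLS π) = (glMap π g).val := by
    ext i j m
    simp only [M, Matrix.map_apply, coeff_mapLS, coeff_posPart, glMap_apply]
    split_ifs with h
    · simpa using (hg.1 i j m h).symm
    · rfl
  have hdet : IsUnit (M.det.coeff 0) := by
    refine hunit _ ?_
    have h1 : π (M.det.coeff 0) = (glMap π g).val.det.coeff 0 := by
      rw [← hMπ, ← RingHom.mapMatrix_apply, ← RingHom.map_det, coeff_mapLS]
    rw [h1]
    refine IsUnit.of_mul_eq_one ((glMap π g)⁻¹.val.det.coeff 0) ?_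
    rw [← coeff_zero_mul_of_mem_pos (det_mem (mem_glSub.mp hg).1) (det_mem (mem_glSub.mp hg).2),
      ← Matrix.det_mul,
      ← Units.val_mul, mul_inv_cancel]
    simp
  obtain ⟨d, hd, hd'⟩ := exists_inv_of_mem_pos (det_mem hM) hdet
  obtain ⟨b, hb, hbM⟩ := exists_mem_glSub_of_det hM hd hd'
  exact ⟨b, hb, Units.ext (by rw [← hMπ, glMap_val, hbM])⟩

theorem factors_of_isLocalRing [IsLocalRing R] (g : GL (Fin n) (LaurentSeries R)) :
    Factors g := by
  have hunit : ∀ r, IsLocalRing.residue R r ≠ 0 → IsUnit r := fun r hr => by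
    by_contra h
    exact hr ((IsLocalRing.residue_eq_zero_iff r).mpr h)
  obtain ⟨a, ha, h⟩ := exists_glMap_mul_mem_pos (IsLocalRing.residue R)
    IsLocalRing.residue_surjective hunit g
  obtain ⟨b, hb, hb'⟩ := exists_mem_pos_glMap_eq (IsLocalRing.residue R)
    (fun r hr => hunit r hr.ne_zero) h
  refine Factors.of_mul_left ha (Factors.of_mul_right (inv_mem hb) ?_)
  have hone : glMap (IsLocalRing.residue R) (a * g * b⁻¹) = 1 := by
    rw [map_mul, map_inv, hb', mul_inv_cancel]
  have hmem : ∀ {x : GL (Fin n) (LaurentSeries R)}, glMap (IsLocalRing.residue R) x = 1 →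
      ∀ i j m, ((x.val - 1) i j).coeff m ∈ IsLocalRing.maximalIdeal R := fun {x} hx i j m => by
    rw [← IsLocalRing.residue_eq_zero_iff, ← coeff_mapLS]
    have : mapLS (IsLocalRing.residue R) ((x.val - 1) i j) = 0 := by
      rw [Matrix.sub_apply, map_sub, ← glMap_apply, hx]
      simp [Matrix.one_apply, apply_ite (mapLS (IsLocalRing.residue R))]
    rw [this, HahnSeries.coeff_zero]
  exact factors_of_sub_one_coeff_mem (IsLocalRing.maximalIdeal_le_jacobson _) _ (hmem hone)
    (hmem (by rw [map_inv, hone, inv_one]))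

end Local

end LaurentSeries

section Patching

variable {R S₁ S₂ D : Type*} [CommRing R] [CommRing S₁] [CommRing S₂] [CommRing D]

theorem exists_of_awayLike {j₁ : R →+* S₁} {j₂ : R →+* S₂} {k₁ : S₁ →+* D} {k₂ : S₂ →+* D}
    (hk : k₁.comp j₁ = k₂.comp j₂) {u u' : R} (hu : u + u' = 1) (J₁ : AwayLike j₁ u)
    (J₂ : AwayLike j₂ u') (H₁ : AwayLike k₁ (j₁ u')) {x₁ : S₁} {x₂ : S₂} (hx : k₁ x₁ = k₂ x₂) :
    ∃ x, j₁ x = x₁ ∧ j₂ x = x₂ := by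
  obtain ⟨N, ⟨y₁, hy₁⟩, ⟨y₂, hy₂⟩⟩ := ((J₁.surj x₁).and (J₂.surj x₂)).exists
  have hz : k₁ (j₁ (u' ^ N * y₁ - u ^ N * y₂)) = 0 := by
    have hk' : ∀ r, k₂ (j₂ r) = k₁ (j₁ r) := fun r => (RingHom.congr_fun hk r).symm
    have h2 := congrArg k₂ hy₂
    simp only [map_mul, map_pow, ← hx, hk'] at h2
    simp only [map_sub, map_mul, map_pow, hy₁, h2]
    ring
  obtain ⟨M, hM⟩ := (H₁.inj _ hz).exists
  rw [← map_pow, ← map_mul] at hM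
  obtain ⟨L, hL⟩ := (J₁.inj _ hM).exists
  obtain ⟨r, r', hr⟩ : IsCoprime (u ^ (M + L + N)) (u' ^ (M + L + N)) :=
    IsCoprime.pow ⟨1, 1, by rwa [one_mul, one_mul]⟩
  have hkey : u' ^ (M + L + N) * (u ^ (M + L) * y₁) = u ^ (M + L + N) * (u' ^ (M + L) * y₂) := by
    linear_combination u ^ M * u' ^ L * hL
  refine ⟨r * (u ^ (M + L) * y₁) + r' * (u' ^ (M + L) * y₂), ?_, ?_⟩
  · refine (J₁.unit.pow (M + L + N)).mul_left_cancel ?_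
    have : u ^ (M + L + N) * (r * (u ^ (M + L) * y₁) + r' * (u' ^ (M + L) * y₂)) =
        u ^ (M + L) * y₁ := by
      linear_combination (u ^ (M + L) * y₁) * hr - r' * hkey
    rw [← map_pow, ← map_mul, this, map_mul, hy₁, map_pow, map_pow]
    ring
  · refine (J₂.unit.pow (M + L + N)).mul_left_cancel ?_
    have : u' ^ (M + L + N) * (r * (u ^ (M + L) * y₁) + r' * (u' ^ (M + L) * y₂)) =
        u' ^ (M + L) * y₂ := by
      linear_combination (u' ^ (M + L) * y₂) * hr + r * hkey
    rw [← map_pow, ← map_mul, this, map_mul, hy₂, map_pow, map_pow]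
    ring

theorem eq_zero_of_awayLike {j₁ : R →+* S₁} {j₂ : R →+* S₂} {u u' : R} (hu : u + u' = 1)
    (J₁ : AwayLike j₁ u) (J₂ : AwayLike j₂ u') {x : R} (h₁ : j₁ x = 0) (h₂ : j₂ x = 0) :
    x = 0 := by
  obtain ⟨N, hN₁, hN₂⟩ := ((J₁.inj x h₁).and (J₂.inj x h₂)).exists
  obtain ⟨r, r', hr⟩ : IsCoprime (u ^ N) (u' ^ N) :=
    IsCoprime.pow ⟨1, 1, by rwa [one_mul, one_mul]⟩
  linear_combination r * hN₁ + r' * hN₂ - x * hr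

/-- A commutative square of rings which is cartesian. -/
structure Glues (j₁ : R →+* S₁) (j₂ : R →+* S₂) (k₁ : S₁ →+* D) (k₂ : S₂ →+* D) : Prop where
  comm : k₁.comp j₁ = k₂.comp j₂
  exists_eq : ∀ x₁ x₂, k₁ x₁ = k₂ x₂ → ∃ x, j₁ x = x₁ ∧ j₂ x = x₂
  eq_zero : ∀ x, j₁ x = 0 → j₂ x = 0 → x = 0

variable {j₁ : R →+* S₁} {j₂ : R →+* S₂} {k₁ : S₁ →+* D} {k₂ : S₂ →+* D} {n : ℕ}

theorem Glues.mapLS (H : Glues j₁ j₂ k₁ k₂) :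
    Glues (mapLS j₁) (mapLS j₂) (mapLS k₁) (mapLS k₂) where
  comm := by rw [mapLS_comp, mapLS_comp, H.comm]
  exists_eq x₁ x₂ hx := by
    choose x hx₁ hx₂ using fun n =>
      H.exists_eq (x₁.coeff n) (x₂.coeff n) (congrArg (fun y => y.coeff n) hx)
    obtain ⟨m₁, hm₁⟩ := exists_pole_bound x₁
    obtain ⟨m₂, hm₂⟩ := exists_pole_bound x₂
    have hbdd : BddBelow (Function.support x) := by
      refine ⟨min m₁ m₂, fun m hm => ?_⟩
      by_contra! h
      exact hm (H.eq_zero _ (by rw [hx₁, hm₁ _ (by grind)]) (by rw [hx₂, hm₂ _ (by grind)]))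
    refine ⟨HahnSeries.ofSuppBddBelow x hbdd, ?_, ?_⟩
    · ext m
      simp [hx₁]
    · ext m
      simp [hx₂]
  eq_zero x h₁ h₂ := by
    ext m
    exact H.eq_zero _ (congrArg (fun y => y.coeff m) h₁) (congrArg (fun y => y.coeff m) h₂)

theorem Glues.mem_fin (H : Glues j₁ j₂ k₁ k₂) {x : LaurentSeries R}
    (h₁ : LaurentLoop.mapLS j₁ x ∈ fin S₁) (h₂ : LaurentLoop.mapLS j₂ x ∈ fin S₂) : x ∈ fin R := by
  obtain ⟨m₁, hm₁⟩ := h₁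
  obtain ⟨m₂, hm₂⟩ := h₂
  exact ⟨max m₁ m₂, fun m hm => H.eq_zero _ (hm₁ m (by grind)) (hm₂ m (by grind))⟩

theorem Glues.mem_pos (H : Glues j₁ j₂ k₁ k₂) {x : LaurentSeries R}
    (h₁ : LaurentLoop.mapLS j₁ x ∈ pos S₁) (h₂ : LaurentLoop.mapLS j₂ x ∈ pos S₂) : x ∈ pos R :=
  fun m hm => H.eq_zero _ (h₁ m hm) (h₂ m hm)

theorem Glues.mem_glSub_fin (H : Glues j₁ j₂ k₁ k₂) {g : GL (Fin n) (LaurentSeries R)}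
    (h₁ : glMap j₁ g ∈ glSub n (fin S₁)) (h₂ : glMap j₂ g ∈ glSub n (fin S₂)) :
    g ∈ glSub n (fin R) :=
  ⟨fun i j => H.mem_fin (h₁.1 i j) (h₂.1 i j), fun i j =>
    H.mem_fin (by simpa using (mem_glSub.mp h₁).2 i j) (by simpa using (mem_glSub.mp h₂).2 i j)⟩

theorem Glues.mem_glSub_pos (H : Glues j₁ j₂ k₁ k₂) {g : GL (Fin n) (LaurentSeries R)}
    (h₁ : glMap j₁ g ∈ glSub n (pos S₁)) (h₂ : glMap j₂ g ∈ glSub n (pos S₂)) :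
    g ∈ glSub n (pos R) :=
  ⟨fun i j => H.mem_pos (h₁.1 i j) (h₂.1 i j), fun i j =>
    H.mem_pos (by simpa using (mem_glSub.mp h₁).2 i j) (by simpa using (mem_glSub.mp h₂).2 i j)⟩

theorem Glues.exists_matrix (H : Glues j₁ j₂ k₁ k₂) {M₁ : Matrix (Fin n) (Fin n) S₁}
    {M₂ : Matrix (Fin n) (Fin n) S₂} (h : M₁.map k₁ = M₂.map k₂) :
    ∃ M : Matrix (Fin n) (Fin n) R, M.map j₁ = M₁ ∧ M.map j₂ = M₂ := by
  choose M hM₁ hM₂ using fun i j => H.exists_eq (M₁ i j) (M₂ i j) (congrFun (congrFun h i) j)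
  exact ⟨Matrix.of M, Matrix.ext hM₁, Matrix.ext hM₂⟩

theorem Glues.matrix_eq (H : Glues j₁ j₂ k₁ k₂) {M N : Matrix (Fin n) (Fin n) R}
    (h₁ : M.map j₁ = N.map j₁) (h₂ : M.map j₂ = N.map j₂) : M = N := by
  ext i j
  refine sub_eq_zero.mp (H.eq_zero _ ?_ ?_)
  · rw [map_sub, sub_eq_zero]
    exact congrFun (congrFun h₁ i) j
  · rw [map_sub, sub_eq_zero]
    exact congrFun (congrFun h₂ i) j

theorem Glues.exists_generalLinearGroup (H : Glues j₁ j₂ k₁ k₂) {g₁ : GL (Fin n) S₁}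
    {g₂ : GL (Fin n) S₂} (h : Matrix.GeneralLinearGroup.map k₁ g₁ =
      Matrix.GeneralLinearGroup.map k₂ g₂) :
    ∃ g, Matrix.GeneralLinearGroup.map j₁ g = g₁ ∧ Matrix.GeneralLinearGroup.map j₂ g = g₂ := by
  obtain ⟨M, hM₁, hM₂⟩ := H.exists_matrix (congrArg Units.val h)
  obtain ⟨N, hN₁, hN₂⟩ := H.exists_matrix (M₁ := g₁⁻¹.val) (M₂ := g₂⁻¹.val)
    (congrArg (fun g => (g⁻¹).val) h)
  have hMN : M * N = 1 := H.matrix_eq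
    (by rw [Matrix.map_mul, hM₁, hN₁, ← Units.val_mul, mul_inv_cancel]; simp)
    (by rw [Matrix.map_mul, hM₂, hN₂, ← Units.val_mul, mul_inv_cancel]; simp)
  exact ⟨⟨M, N, hMN, mul_eq_one_comm.mp hMN⟩, Units.ext hM₁, Units.ext hM₂⟩

theorem map_coeff_zero_mul {M N : Matrix (Fin n) (Fin n) (LaurentSeries R)}
    (hM : ∀ i j, M i j ∈ pos R) (hN : ∀ i j, N i j ∈ pos R) :
    (M * N).map (fun x => x.coeff 0) = M.map (fun x => x.coeff 0) * N.map (fun x => x.coeff 0) := by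
  ext i j
  simp only [Matrix.map_apply, Matrix.mul_apply]
  rw [HahnSeries.coeff_sum]
  exact Finset.sum_congr rfl fun k _ => coeff_zero_mul_of_mem_pos (hM i k) (hN k j)

theorem map_coeff_zero_one :
    (1 : Matrix (Fin n) (Fin n) (LaurentSeries R)).map (fun x => x.coeff 0) = 1 :=
  Matrix.map_one _ (HahnSeries.coeff_zero) (by simp)

theorem glMap_map_coeff_zero {S : Type*} [CommRing S] (f : R →+* S)
    {g : GL (Fin n) (LaurentSeries R)} (hg : g.val.map (fun x => x.coeff 0) = 1) :
    (glMap f g).val.map (fun x => x.coeff 0) = 1 := by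
  have h := congrArg (fun M => M.map f) hg
  rw [Matrix.map_one _ (map_zero f) (map_one f)] at h
  exact h

theorem Factors.exists_coeff_zero_eq_one {g : GL (Fin n) (LaurentSeries R)} (hg : Factors g) :
    ∃ a ∈ glSub n (fin R), ∃ b ∈ glSub n (pos R), g = a * b ∧
      b.val.map (fun x => x.coeff 0) = 1 := by
  obtain ⟨a, ha, b, hb, rfl⟩ := hg
  let c : GL (Fin n) R := ⟨b.val.map (fun x => x.coeff 0), b⁻¹.val.map (fun x => x.coeff 0),
    by rw [← map_coeff_zero_mul (mem_glSub.mp hb).1 (mem_glSub.mp hb).2, ← Units.val_mul,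
        mul_inv_cancel, Units.val_one, map_coeff_zero_one],
    by rw [← map_coeff_zero_mul (mem_glSub.mp hb).2 (mem_glSub.mp hb).1, ← Units.val_mul,
        inv_mul_cancel, Units.val_one, map_coeff_zero_one]⟩
  let e : GL (Fin n) (LaurentSeries R) := Matrix.GeneralLinearGroup.map HahnSeries.C c
  have hef : e ∈ glSub n (fin R) := ⟨fun i j => C_mem_fin _, fun i j => C_mem_fin _⟩
  have hep : e ∈ glSub n (pos R) := ⟨fun i j => C_mem_pos _, fun i j => C_mem_pos _⟩
  refine ⟨a * e, mul_mem ha hef, e⁻¹ * b, mul_mem (inv_mem hep) hb, by group, ?_⟩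
  rw [Units.val_mul, map_coeff_zero_mul (mem_glSub.mp hep).2 (mem_glSub.mp hb).1]
  have : e⁻¹.val.map (fun x => x.coeff 0) = c⁻¹.val := by
    ext i j
    exact HahnSeries.coeff_single_same 0 (c⁻¹.val i j)
  rw [this]
  exact c.inv_mul

/-- The inclusion of the polynomials in the Laurent series. -/
noncomputable def polyLS (R : Type*) [CommRing R] : Polynomial R →+* LaurentSeries R :=
  (HahnSeries.ofPowerSeries ℤ R).comp Polynomial.coeToPowerSeries.ringHom

theorem coeff_polyLS (p : Polynomial R) (m : ℤ) :
    (polyLS R p).coeff m = if m < 0 then 0 else p.coeff m.natAbs := by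
  simp only [polyLS, RingHom.comp_apply, Polynomial.coeToPowerSeries.ringHom_apply]
  rw [PowerSeries.coeff_coe, Polynomial.coeff_coe]

theorem polyLS_injective : Function.Injective (polyLS R) := fun p q h => by
  ext m
  simpa [coeff_polyLS, not_lt.mpr (Int.natCast_nonneg m)] using
    congrArg (fun x => x.coeff (m : ℤ)) h

theorem polyLS_mem_pos (p : Polynomial R) : polyLS R p ∈ pos R := fun m hm => by
  rw [coeff_polyLS, if_pos hm]

theorem polyLS_mem_fin (p : Polynomial R) : polyLS R p ∈ fin R :=
  ⟨p.natDegree, fun m hm => by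
    rw [coeff_polyLS, Polynomial.coeff_eq_zero_of_natDegree_lt (by lia), ite_self]⟩

theorem exists_polyLS_eq {x : LaurentSeries R} (hf : x ∈ fin R) (hp : x ∈ pos R) :
    ∃ p, polyLS R p = x := by
  obtain ⟨m, hm⟩ := hf
  refine ⟨∑ i ∈ Finset.range (m.natAbs + 1), Polynomial.monomial i (x.coeff i), ?_⟩
  ext k
  rw [coeff_polyLS]
  split_ifs with hk
  · exact (hp k hk).symm
  · obtain ⟨k, rfl⟩ := Int.eq_ofNat_of_zero_le (not_lt.mp hk)
    simp only [Int.natAbs_natCast, Polynomial.finsetSum_coeff, Polynomial.coeff_monomial,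
      Finset.sum_ite_eq', Finset.mem_range]
    split_ifs with h
    · rfl
    · exact (hm k (by lia)).symm

theorem mapLS_polyLS {S : Type*} [CommRing S] (f : R →+* S) (p : Polynomial R) :
    mapLS f (polyLS R p) = polyLS S (p.map f) := by
  ext m
  simp [coeff_polyLS, apply_ite f]

theorem map_polyLS_map_mapLS {S : Type*} [CommRing S] (f : R →+* S)
    (M : Matrix (Fin n) (Fin n) (Polynomial R)) :
    (M.map (polyLS R)).map (mapLS f) = (M.map (Polynomial.mapRingHom f)).map (polyLS S) := by
  ext1 i j
  simp [mapLS_polyLS]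

theorem exists_mem_glSub_of_polynomial {M N : Matrix (Fin n) (Fin n) (Polynomial R)}
    (h : M * N = 1) :
    ∃ g : GL (Fin n) (LaurentSeries R), g ∈ glSub n (fin R) ∧ g ∈ glSub n (pos R) ∧
      g.val = M.map (polyLS R) :=
  ⟨Matrix.GeneralLinearGroup.map (polyLS R) ⟨M, N, h, mul_eq_one_comm.mp h⟩,
    ⟨fun _ _ => polyLS_mem_fin _, fun _ _ => polyLS_mem_fin _⟩,
    ⟨fun _ _ => polyLS_mem_pos _, fun _ _ => polyLS_mem_pos _⟩, rfl⟩

theorem exists_matrix_polyLS_eq {M : Matrix (Fin n) (Fin n) (LaurentSeries R)}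
    (hf : ∀ i j, M i j ∈ fin R) (hp : ∀ i j, M i j ∈ pos R) :
    ∃ P : Matrix (Fin n) (Fin n) (Polynomial R), P.map (polyLS R) = M := by
  choose P hP using fun i j => exists_polyLS_eq (hf i j) (hp i j)
  exact ⟨Matrix.of P, Matrix.ext hP⟩

theorem exists_factorization_of_mem_fin_of_mem_pos (hk : k₁.comp j₁ = k₂.comp j₂) {u u' : R}
    (hu : u + u' = 1) (H₁ : AwayLike k₁ (j₁ u')) (H₂ : AwayLike k₂ (j₂ u))
    {t : GL (Fin n) (LaurentSeries D)} (hf : t ∈ glSub n (fin D)) (hp : t ∈ glSub n (pos D))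
    (ht : t.val.map (fun x => x.coeff 0) = 1) :
    ∃ (e₁ : GL (Fin n) (LaurentSeries S₁)) (e₂ : GL (Fin n) (LaurentSeries S₂)),
      e₁ ∈ glSub n (fin S₁) ∧ e₁ ∈ glSub n (pos S₁) ∧
      e₂ ∈ glSub n (fin S₂) ∧ e₂ ∈ glSub n (pos S₂) ∧ t = glMap k₁ e₁ * glMap k₂ e₂ := by
  obtain ⟨θ, hθ⟩ := exists_matrix_polyLS_eq (mem_glSub.mp hf).1 (mem_glSub.mp hp).1
  obtain ⟨θ', hθ'⟩ := exists_matrix_polyLS_eq (mem_glSub.mp hf).2 (mem_glSub.mp hp).2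
  have hone : θ * θ' = 1 := by
    refine Matrix.map_injective polyLS_injective ?_
    simp only [Matrix.map_mul, hθ, hθ', ← Units.val_mul, mul_inv_cancel]
    simp
  have hθ0 : θ.map (Polynomial.eval 0) = 1 := by
    rw [← ht, ← hθ]
    ext i j
    simp [coeff_polyLS, Polynomial.coeff_zero_eq_eval_zero]
  obtain ⟨α₁, α₁', α₂, α₂', h₁, h₂, h⟩ := exists_polynomial_factorization hk hu H₁ H₂ hone hθ0
  obtain ⟨e₁, hf₁, hp₁, he₁⟩ := exists_mem_glSub_of_polynomial h₁
  obtain ⟨e₂, hf₂, hp₂, he₂⟩ := exists_mem_glSub_of_polynomial h₂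
  refine ⟨e₁, e₂, hf₁, hp₁, hf₂, hp₂, Units.ext ?_⟩
  rw [Units.val_mul, glMap_val, glMap_val, he₁, he₂, map_polyLS_map_mapLS,
    map_polyLS_map_mapLS, ← Matrix.map_mul, ← h, hθ]

theorem factors_of_factors_glMap (H : Glues j₁ j₂ k₁ k₂) {u u' : R} (hu : u + u' = 1)
    (H₁ : AwayLike k₁ (j₁ u')) (H₂ : AwayLike k₂ (j₂ u)) {g : GL (Fin n) (LaurentSeries R)}
    (h₁ : Factors (glMap j₁ g)) (h₂ : Factors (glMap j₂ g)) : Factors g := by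
  obtain ⟨a₁, ha₁, b₁, hb₁, hg₁, hb₁0⟩ := h₁.exists_coeff_zero_eq_one
  obtain ⟨a₂, ha₂, b₂, hb₂, hg₂, hb₂0⟩ := h₂.exists_coeff_zero_eq_one
  have hD : glMap k₁ a₁ * glMap k₁ b₁ = glMap k₂ a₂ * glMap k₂ b₂ := by
    rw [← map_mul, ← map_mul, ← hg₁, ← hg₂, glMap_glMap, glMap_glMap, H.comm]
  have ht : (glMap k₁ a₁)⁻¹ * glMap k₂ a₂ = glMap k₁ b₁ * (glMap k₂ b₂)⁻¹ := by
    rw [inv_mul_eq_iff_eq_mul, ← mul_assoc, hD, mul_inv_cancel_right]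
  have hpos : glMap k₁ b₁ * (glMap k₂ b₂)⁻¹ ∈ glSub n (pos D) :=
    mul_mem (glMap_mem_pos k₁ hb₁) (inv_mem (glMap_mem_pos k₂ hb₂))
  have hfin : glMap k₁ b₁ * (glMap k₂ b₂)⁻¹ ∈ glSub n (fin D) := by
    rw [← ht]
    exact mul_mem (inv_mem (glMap_mem_fin k₁ ha₁)) (glMap_mem_fin k₂ ha₂)
  have ht0 : (glMap k₁ b₁ * (glMap k₂ b₂)⁻¹).val.map (fun x => x.coeff 0) = 1 := by
    have hb := glMap_mem_pos k₂ hb₂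
    have h := map_coeff_zero_mul (mem_glSub.mp hpos).1 (mem_glSub.mp hb).1
    rw [← Units.val_mul, inv_mul_cancel_right, glMap_map_coeff_zero k₁ hb₁0,
      glMap_map_coeff_zero k₂ hb₂0, mul_one] at h
    exact h.symm
  obtain ⟨e₁, e₂, hf₁, hp₁, hf₂, hp₂, he⟩ :=
    exists_factorization_of_mem_fin_of_mem_pos H.comm hu H₁ H₂ hfin hpos ht0
  have hc : glMap k₁ (a₁ * e₁) = glMap k₂ (a₂ * e₂⁻¹) := by
    rw [map_mul, map_mul, map_inv, eq_mul_inv_iff_mul_eq, mul_assoc, ← he, ← ht,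
      mul_inv_cancel_left]
  obtain ⟨c, hc₁, hc₂⟩ := H.mapLS.exists_generalLinearGroup hc
  have hc₁ : glMap j₁ c = a₁ * e₁ := hc₁
  have hc₂ : glMap j₂ c = a₂ * e₂⁻¹ := hc₂
  refine ⟨c, H.mem_glSub_fin ?_ ?_, c⁻¹ * g, H.mem_glSub_pos ?_ ?_, by group⟩
  · rw [hc₁]
    exact mul_mem ha₁ hf₁
  · rw [hc₂]
    exact mul_mem ha₂ (inv_mem hf₂)
  · rw [map_mul, map_inv, hc₁, hg₁, mul_inv_rev, mul_assoc, inv_mul_cancel_left]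
    exact mul_mem (inv_mem hp₁) hb₁
  · rw [map_mul, map_inv, hc₂, hg₂, mul_inv_rev, inv_inv, mul_assoc, inv_mul_cancel_left]
    exact mul_mem hp₂ hb₂

end Patching

section Descent

open HahnSeries

variable {R L : Type*} [CommRing R] [CommRing L] [Algebra R L] (M : Submonoid R)
  [IsLocalization M L] {n : ℕ}

theorem exists_mul_eq_zero_of_finite {κ : Type*} [Finite κ] {z : κ → R}
    (hz : ∀ k, algebraMap R L (z k) = 0) : ∃ s ∈ M, ∀ k, s * z k = 0 := by
  have := Fintype.ofFinite κ
  choose c hc using fun k => (IsLocalization.map_eq_zero_iff M L (z k)).mp (hz k)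
  refine ⟨∏ k, (c k : R), prod_mem fun k _ => (c k).2, fun k => ?_⟩
  obtain ⟨d, hd⟩ := Finset.dvd_prod_of_mem (fun k => (c k : R)) (Finset.mem_univ k)
  rw [hd, mul_right_comm, hc, zero_mul]

theorem exists_mul_coeff_eq_zero {X : Matrix (Fin n) (Fin n) (LaurentSeries R)} {m : ℤ}
    (hX : ∀ i j, ∀ k ≤ m, algebraMap R L ((X i j).coeff k) = 0) :
    ∃ s ∈ M, ∀ i j, ∀ k ≤ m, s * (X i j).coeff k = 0 := by
  obtain ⟨K, hK⟩ := (eventually_pole_bound X).exists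
  obtain ⟨s, hs, h⟩ := exists_mul_eq_zero_of_finite (L := L) M
    (z := fun k : Fin n × Fin n × Set.Icc (-K : ℤ) m => (X k.1 k.2.1).coeff k.2.2)
    (fun k => hX _ _ _ k.2.2.2.2)
  refine ⟨s, hs, fun i j k hk => ?_⟩
  rcases lt_or_ge k (-K : ℤ) with h' | h'
  · rw [hK i j k h', mul_zero]
  · exact h (i, j, ⟨k, h', hk⟩)

theorem exists_map_eq_C_mul {X : Matrix (Fin n) (Fin n) (LaurentSeries L)}
    (hX : ∀ i j, X i j ∈ fin L) :
    ∃ s ∈ M, ∃ Y : Matrix (Fin n) (Fin n) (LaurentSeries R), (∀ i j, Y i j ∈ fin R) ∧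
      ∀ i j, mapLS (algebraMap R L) (Y i j) = HahnSeries.C (algebraMap R L s) * X i j := by
  obtain ⟨K, hK, hK'⟩ := ((eventually_pole_bound X).and (eventually_degree_bound hX)).exists
  obtain ⟨s, hs⟩ := IsLocalization.exist_integer_multiples M
    (Finset.univ ×ˢ Finset.univ ×ˢ Finset.Icc (-K : ℤ) K)
    (fun k : Fin n × Fin n × ℤ => (X k.1 k.2.1).coeff k.2.2)
  have h : ∀ i j k, ∃ y, algebraMap R L y = algebraMap R L s * (X i j).coeff k ∧
      (k < -K ∨ k > K → y = 0) := fun i j k => by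
    by_cases hk : k < -K ∨ k > K
    · refine ⟨0, ?_, fun _ => rfl⟩
      rw [hk.elim (hK i j k) (hK' i j k), mul_zero, map_zero]
    · obtain ⟨y, hy⟩ := hs (i, j, k) (by simp; lia)
      exact ⟨y, hy.trans (Algebra.smul_def _ _), fun h => absurd h hk⟩
  choose y hy hy0 using h
  have hbdd : ∀ i j, BddBelow (Function.support (y i j)) := fun i j =>
    ⟨-K, fun k hk => by
      by_contra! h
      exact hk (hy0 i j k (.inl h))⟩
  refine ⟨s, s.2, Matrix.of fun i j => ofSuppBddBelow (y i j) (hbdd i j),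
    fun i j => ⟨K, fun k hk => hy0 i j k (.inr hk)⟩, fun i j => ?_⟩
  ext k
  rw [coeff_mapLS, C_mul_eq_smul, coeff_smul, smul_eq_mul]
  exact hy i j k

theorem map_eq_zero_of_mul_eq_zero {T : Type*} [CommRing T] (f : R →+* T) {s z : R}
    (hs : IsUnit (f s)) (h : s * z = 0) : f z = 0 :=
  hs.mul_left_cancel (by rw [← map_mul, h, map_zero, mul_zero])

theorem exists_forall_factors_of_isLocalization {g : GL (Fin n) (LaurentSeries R)}
    (hg : Factors (glMap (algebraMap R L) g)) :
    ∃ s ∈ M, ∀ (T : Type*) [CommRing T] (f : R →+* T), IsUnit (f s) → Factors (glMap f g) := by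
  obtain ⟨a, ha, b, hb, hab⟩ := hg
  obtain ⟨s, hs, α, hα, hαa⟩ := exists_map_eq_C_mul M (mem_glSub.mp ha).1
  obtain ⟨s', hs', α', hα', hαa'⟩ := exists_map_eq_C_mul M (mem_glSub.mp ha).2
  have hmapα : α.map (mapLS (algebraMap R L)) =
      HahnSeries.C (Γ := ℤ) (algebraMap R L s) • a.val := by
    ext1 i j
    rw [Matrix.smul_apply, smul_eq_mul]
    exact hαa i j
  have hmapα' : α'.map (mapLS (algebraMap R L)) =
      HahnSeries.C (Γ := ℤ) (algebraMap R L s') • a⁻¹.val := by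
    ext1 i j
    rw [Matrix.smul_apply, smul_eq_mul]
    exact hαa' i j
  have hb₁ : (α' * g.val).map (mapLS (algebraMap R L)) =
      HahnSeries.C (Γ := ℤ) (algebraMap R L s') • b.val := by
    rw [Matrix.map_mul, hmapα', ← glMap_val, hab, smul_mul_assoc, ← Units.val_mul,
      inv_mul_cancel_left]
  have hb₂ : (g⁻¹.val * α).map (mapLS (algebraMap R L)) =
      HahnSeries.C (Γ := ℤ) (algebraMap R L s) • b⁻¹.val := by
    rw [Matrix.map_mul, hmapα, ← glMap_val, map_inv, hab, mul_smul_comm, ← Units.val_mul]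
    congr 2
    group
  let E : Matrix (Fin n) (Fin n) (LaurentSeries R) := α * α' - HahnSeries.C (Γ := ℤ) (s * s') • 1
  have hE : E.map (mapLS (algebraMap R L)) = 0 := by
    have : (HahnSeries.C (Γ := ℤ) (s * s') • (1 : Matrix (Fin n) (Fin n) (LaurentSeries R))).map
        (mapLS (algebraMap R L)) = HahnSeries.C (Γ := ℤ) (algebraMap R L (s * s')) • 1 := by
      ext1 i j
      simp [Matrix.one_apply, apply_ite (mapLS (algebraMap R L)), C_apply]
    rw [Matrix.map_sub _ (map_sub _), Matrix.map_mul, hmapα, hmapα', this, smul_mul_smul_comm,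
      ← Units.val_mul, mul_inv_cancel, map_mul, map_mul, Units.val_one, sub_self]
  have hEfin : ∀ i j, E i j ∈ fin R := fun i j => by
    refine sub_mem (mul_apply_mem hα hα' i j) ?_
    rw [Matrix.smul_apply, smul_eq_mul]
    exact mul_mem (C_mem_fin _) (one_apply_mem _ _ _)
  obtain ⟨K, hK⟩ := (eventually_degree_bound hEfin).exists
  obtain ⟨s₁, hs₁, h₁⟩ := exists_mul_coeff_eq_zero (L := L) M (X := E) (m := K) fun i j k _ =>
    congrArg (fun x => x.coeff k) (congrFun (congrFun hE i) j)
  obtain ⟨s₂, hs₂, h₂⟩ := exists_mul_coeff_eq_zero (L := L) M (X := α' * g.val) (m := -1)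
    fun i j k hk => by
      refine (congrArg (fun x => x.coeff k) (congrFun (congrFun hb₁ i) j)).trans ?_
      exact mul_mem (C_mem_pos _) (hb.1 i j) k (by lia)
  obtain ⟨s₃, hs₃, h₃⟩ := exists_mul_coeff_eq_zero (L := L) M (X := g⁻¹.val * α) (m := -1)
    fun i j k hk => by
      refine (congrArg (fun x => x.coeff k) (congrFun (congrFun hb₂ i) j)).trans ?_
      exact mul_mem (C_mem_pos _) (hb.2 i j) k (by lia)
  refine ⟨s * s' * (s₁ * s₂ * s₃), mul_mem (mul_mem hs hs') (mul_mem (mul_mem hs₁ hs₂) hs₃),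
    fun T _ f hf => ?_⟩
  simp only [map_mul, IsUnit.mul_iff] at hf
  obtain ⟨⟨hfs, hfs'⟩, ⟨hf₁, hf₂⟩, hf₃⟩ := hf
  obtain ⟨v, hv⟩ := hfs.exists_left_inv
  obtain ⟨v', hv'⟩ := hfs'.exists_left_inv
  have hET : E.map (mapLS f) = 0 := by
    ext i j k
    refine map_eq_zero_of_mul_eq_zero f hf₁ ?_
    rcases le_or_gt k K with hk | hk
    · exact h₁ i j k hk
    · rw [hK i j k hk, mul_zero]
  have hαα' : α.map (mapLS f) * α'.map (mapLS f) = HahnSeries.C (Γ := ℤ) (f s * f s') • 1 := by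
    have : (HahnSeries.C (Γ := ℤ) (s * s') • (1 : Matrix (Fin n) (Fin n) (LaurentSeries R))).map
        (mapLS f) = HahnSeries.C (Γ := ℤ) (f s * f s') • 1 := by
      ext1 i j
      simp [Matrix.one_apply, apply_ite (mapLS f), C_apply]
    rwa [Matrix.map_sub _ (map_sub _), Matrix.map_mul, this, sub_eq_zero] at hET
  have hone : (HahnSeries.C (Γ := ℤ) v • α.map (mapLS f)) *
      (HahnSeries.C (Γ := ℤ) v' • α'.map (mapLS f)) = 1 := by
    rw [smul_mul_smul_comm, hαα', smul_smul, ← map_mul, ← map_mul]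
    have : v * v' * (f s * f s') = 1 := by linear_combination f s' * v' * hv + hv'
    rw [this, map_one, one_smul]
  let a' : GL (Fin n) (LaurentSeries T) := ⟨_, _, hone, mul_eq_one_comm.mp hone⟩
  refine ⟨a', ⟨fun i j => (fin T).mul_mem (C_mem_fin _) (mapLS_mem_fin f (hα i j)),
    fun i j => (fin T).mul_mem (C_mem_fin _) (mapLS_mem_fin f (hα' i j))⟩,
    a'⁻¹ * glMap f g, ?_, by group⟩
  have hpos₁ : ∀ i j, (a'⁻¹ * glMap f g).val i j ∈ pos T := fun i j => by
    have : (a'⁻¹ * glMap f g).val = HahnSeries.C (Γ := ℤ) v' • (α' * g.val).map (mapLS f) := by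
      rw [Matrix.map_mul, ← smul_mul_assoc]
      rfl
    rw [this]
    exact mul_mem (C_mem_pos _) fun k hk => map_eq_zero_of_mul_eq_zero f hf₂ (h₂ i j k (by lia))
  have hpos₂ : ∀ i j, ((a'⁻¹ * glMap f g)⁻¹).val i j ∈ pos T := fun i j => by
    have : ((a'⁻¹ * glMap f g)⁻¹).val = HahnSeries.C (Γ := ℤ) v • (g⁻¹.val * α).map (mapLS f) := by
      rw [mul_inv_rev, inv_inv, Matrix.map_mul, ← mul_smul_comm]
      rfl
    rw [this]
    exact mul_mem (C_mem_pos _) fun k hk => map_eq_zero_of_mul_eq_zero f hf₃ (h₃ i j k (by lia))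
  exact ⟨hpos₁, hpos₂⟩

end Descent

section Assembly

variable {R : Type*} [CommRing R] {n : ℕ}

theorem factors_of_add_eq_one {u u' : R} (hu : u + u' = 1) {g : GL (Fin n) (LaurentSeries R)}
    (h : Factors (glMap (algebraMap R (Localization.Away u)) g))
    (h' : Factors (glMap (algebraMap R (Localization.Away u')) g)) : Factors g := by
  let S := Localization.Away u
  let S' := Localization.Away u'
  let D := Localization.Away (algebraMap R S u')
  let k' : S' →+* D := IsLocalization.Away.lift u' (g := (algebraMap S D).comp (algebraMap R S))
    (IsLocalization.Away.algebraMap_isUnit (algebraMap R S u'))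
  have hk : (algebraMap S D).comp (algebraMap R S) = k'.comp (algebraMap R S') :=
    (IsLocalization.Away.lift_comp u' _).symm
  have H : AwayLike (algebraMap S D) (algebraMap R S u') := awayLike_of_isLocalization
  have J : AwayLike (algebraMap R S) u := awayLike_of_isLocalization
  have J' : AwayLike (algebraMap R S') u' := awayLike_of_isLocalization
  have H' : AwayLike k' (algebraMap R S' u) := by
    let : Algebra S' D := k'.toAlgebra
    have : IsScalarTower R S' D :=
      IsScalarTower.of_algebraMap_eq' ((IsScalarTower.algebraMap_eq R S D).trans hk)
    have : IsLocalization.Away (algebraMap R S' u) D := IsLocalization.Away.commutes S' S D u' u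
    have h : AwayLike (algebraMap S' D) (algebraMap R S' u) := awayLike_of_isLocalization
    exact h
  exact factors_of_factors_glMap ⟨hk, fun x x' => exists_of_awayLike hk hu J J' H,
    fun x => eq_zero_of_awayLike hu J J'⟩ hu H H' h h'

/-- The ideal of elements whose inversion makes `g` a product of a polynomial and a positive
loop. -/
def factorsIdeal {R : Type u} [CommRing R] (g : GL (Fin n) (LaurentSeries R)) : Ideal R where
  carrier := {s | ∀ (T : Type u) [CommRing T] (f : R →+* T), IsUnit (f s) → Factors (glMap f g)}
  zero_mem' T _ f hf := by
    rw [map_zero, isUnit_zero_iff] at hf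
    have := subsingleton_of_zero_eq_one hf
    have : Subsingleton (LaurentSeries T) := ⟨fun x y => by ext; exact Subsingleton.elim _ _⟩
    exact ⟨1, one_mem _, 1, one_mem _, Units.ext (Subsingleton.elim _ _)⟩
  smul_mem' r s hs T _ f hf := by
    rw [smul_eq_mul, map_mul, IsUnit.mul_iff] at hf
    exact hs T f hf.2
  add_mem' {s s'} hs hs' T _ f hf := by
    obtain ⟨v, hv⟩ := hf.exists_left_inv
    have key : ∀ {s : R}, (∀ (T : Type u) [CommRing T] (f : R →+* T), IsUnit (f s) →
        Factors (glMap f g)) →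
        Factors (glMap (algebraMap T (Localization.Away (v * f s))) (glMap f g)) := fun {s} hs => by
      rw [glMap_glMap]
      have h : IsUnit (algebraMap T (Localization.Away (v * f s)) (v * f s)) :=
        IsLocalization.Away.algebraMap_isUnit _
      rw [map_mul, IsUnit.mul_iff] at h
      exact hs _ _ h.2
    exact factors_of_add_eq_one (by rw [← mul_add, ← map_add, hv]) (key hs) (key hs')

theorem factors (g : GL (Fin n) (LaurentSeries R)) : Factors g := by
  suffices h : factorsIdeal g = ⊤ by
    have h1 : (1 : R) ∈ factorsIdeal g := h ▸ Submodule.mem_top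
    have h2 := h1 R (RingHom.id R) (by simp)
    have h3 : glMap (RingHom.id R) g = g := by ext; simp
    rwa [h3] at h2
  by_contra h
  obtain ⟨m, hm, hle⟩ := Ideal.exists_le_maximal _ h
  obtain ⟨s, hs, hsT⟩ := exists_forall_factors_of_isLocalization m.primeCompl
    (factors_of_isLocalRing (glMap (algebraMap R (Localization.AtPrime m)) g))
  exact hs (hle hsT)

end Assembly

section Comparison

variable {A : Type*} [CommRing A] {n : ℕ}

/-- The identification of the localization of the power series ring with the Laurent series. -/
noncomputable def awayEquiv (A : Type*) [CommRing A] :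
    Localization.Away (PowerSeries.X : PowerSeries A) ≃ₐ[PowerSeries A] LaurentSeries A :=
  IsLocalization.algEquiv (Submonoid.powers (PowerSeries.X : PowerSeries A)) _ _

/-- The ring homomorphism underlying `awayEquiv`. -/
noncomputable def awayHom (A : Type*) [CommRing A] :
    Localization.Away (PowerSeries.X : PowerSeries A) →+* LaurentSeries A :=
  (awayEquiv A).toAlgHom.toRingHom

theorem awayHom_injective (A : Type*) [CommRing A] : Function.Injective (awayHom A) :=
  (awayEquiv A).injective

theorem awayHom_algebraMap (p : PowerSeries A) :
    awayHom A (algebraMap _ _ p) = HahnSeries.ofPowerSeries ℤ A p :=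
  (awayEquiv A).commutes p

/-- The inclusion of the Laurent polynomials in the Laurent series. -/
noncomputable def laurentPolyLS (A : Type*) [CommRing A] :
    LaurentPolynomial A →+* LaurentSeries A :=
  (awayHom A).comp (laurentInclusion A)

theorem laurentPolyLS_toLaurent (p : Polynomial A) :
    laurentPolyLS A (Polynomial.toLaurent p) = HahnSeries.ofPowerSeries ℤ A p := by
  have : laurentInclusion A (algebraMap (Polynomial A) (LaurentPolynomial A) p) =
      algebraMap (PowerSeries A) _ (p : PowerSeries A) := by
    rw [laurentInclusion, IsLocalization.Away.lift_eq]
    rfl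
  rw [← LaurentPolynomial.algebraMap_eq_toLaurent]
  change awayHom A (laurentInclusion A _) = _
  rw [this, awayHom_algebraMap]

theorem laurentPolyLS_T (k : ℤ) :
    laurentPolyLS A (LaurentPolynomial.T k) = HahnSeries.single k 1 := by
  have hnat : ∀ m : ℕ, laurentPolyLS A (LaurentPolynomial.T m) = HahnSeries.single (m : ℤ) 1 :=
    fun m => by
      rw [← Polynomial.toLaurent_X_pow, laurentPolyLS_toLaurent, Polynomial.coe_pow,
        Polynomial.coe_X, HahnSeries.ofPowerSeries_X_pow]
  obtain ⟨m, rfl | rfl⟩ := Int.eq_nat_or_neg k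
  · exact hnat m
  · have h1 : laurentPolyLS A (LaurentPolynomial.T (-m)) * HahnSeries.single (m : ℤ) 1 = 1 := by
      rw [← hnat, ← map_mul, ← LaurentPolynomial.T_add, neg_add_cancel, LaurentPolynomial.T_zero,
        map_one]
    have h2 : (HahnSeries.single (m : ℤ) (1 : A)) * HahnSeries.single (-m : ℤ) 1 = 1 := by simp
    exact left_inv_eq_right_inv h1 h2

theorem laurentPolyLS_C_mul_T (r : A) (k : ℤ) :
    laurentPolyLS A (LaurentPolynomial.C r * LaurentPolynomial.T k) = HahnSeries.single k r := by
  rw [map_mul, laurentPolyLS_T, ← Polynomial.toLaurent_C, laurentPolyLS_toLaurent,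
    Polynomial.coe_C, HahnSeries.ofPowerSeries_C, HahnSeries.C_apply,
    HahnSeries.single_mul_single, zero_add, mul_one]

theorem coeff_laurentPolyLS (p : LaurentPolynomial A) (k : ℤ) :
    (laurentPolyLS A p).coeff k = p.coeff k := by
  induction p using LaurentPolynomial.induction_on' with
  | add p q hp hq => rw [map_add, HahnSeries.coeff_add, hp, hq]; rfl
  | C_mul_T m a =>
    rw [laurentPolyLS_C_mul_T, ← LaurentPolynomial.single_eq_C_mul_T, AddMonoidAlgebra.coeff_single]
    by_cases h : k = m
    · subst h
      simp
    · rw [HahnSeries.coeff_single_of_ne h, Finsupp.single_eq_of_ne h]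

theorem laurentPolyLS_injective : Function.Injective (laurentPolyLS A) := fun p q h => by
  ext k
  rw [← coeff_laurentPolyLS, h, coeff_laurentPolyLS]

theorem exists_laurentPolyLS_eq {x : LaurentSeries A} (hx : x ∈ fin A) :
    ∃ p, laurentPolyLS A p = x := by
  obtain ⟨m, hm⟩ := hx
  obtain ⟨l, hl⟩ := exists_pole_bound x
  refine ⟨∑ k ∈ Finset.Icc l m, LaurentPolynomial.C (x.coeff k) * LaurentPolynomial.T k, ?_⟩
  ext k
  simp only [map_sum, laurentPolyLS_C_mul_T, HahnSeries.coeff_sum]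
  rw [Finset.sum_eq_single k fun j _ hj => HahnSeries.coeff_single_of_ne hj.symm,
    HahnSeries.coeff_single_same]
  intro h
  rw [HahnSeries.coeff_single_same]
  rw [Finset.mem_Icc, not_and_or, not_le, not_le] at h
  exact h.elim (hl k) (hm k)

theorem exists_map_eq_of_mem_glSub {P L : Type*} [CommRing P] [CommRing L] {φ : P →+* L}
    (hφ : Function.Injective φ) {B : Subring L} (hB : ∀ x ∈ B, ∃ p, φ p = x) {g : GL (Fin n) L}
    (hg : g ∈ glSub n B) : ∃ g₀, Matrix.GeneralLinearGroup.map φ g₀ = g := by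
  choose M hM using fun i j => hB _ (hg.1 i j)
  choose N hN using fun i j => hB _ (hg.2 i j)
  have hM' : (Matrix.of M).map φ = g.val := Matrix.ext hM
  have hN' : (Matrix.of N).map φ = g⁻¹.val := Matrix.ext hN
  have h : Matrix.of M * Matrix.of N = 1 := by
    refine Matrix.map_injective hφ ?_
    simp only [Matrix.map_mul, hM', hN', ← Units.val_mul, mul_inv_cancel]
    simp
  exact ⟨⟨_, _, h, mul_eq_one_comm.mp h⟩, Units.ext hM'⟩

theorem eq_map_mul_map_of_mem_glSub {P Q L₀ L : Type*} [CommRing P] [CommRing Q] [CommRing L₀]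
    [CommRing L] {e : L₀ →+* L} (he : Function.Injective e) {φ : P →+* L₀} {ψ : Q →+* L₀}
    {B₁ B₂ : Subring L} (hφ : Function.Injective (e.comp φ))
    (h₁ : ∀ x ∈ B₁, ∃ p, e.comp φ p = x) (hψ : Function.Injective (e.comp ψ))
    (h₂ : ∀ x ∈ B₂, ∃ q, e.comp ψ q = x) {g : GL (Fin n) L₀} {a b : GL (Fin n) L}
    (ha : a ∈ glSub n B₁) (hb : b ∈ glSub n B₂)
    (h : Matrix.GeneralLinearGroup.map e g = a * b) :
    ∃ a₀ b₀, g = Matrix.GeneralLinearGroup.map φ a₀ * Matrix.GeneralLinearGroup.map ψ b₀ := by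
  obtain ⟨a₀, rfl⟩ := exists_map_eq_of_mem_glSub hφ h₁ ha
  obtain ⟨b₀, rfl⟩ := exists_map_eq_of_mem_glSub hψ h₂ hb
  refine ⟨a₀, b₀, Units.ext (Matrix.map_injective he ?_)⟩
  rw [Matrix.GeneralLinearGroup.map_comp, Matrix.GeneralLinearGroup.map_comp, MonoidHom.comp_apply,
    MonoidHom.comp_apply, ← map_mul] at h
  exact congrArg Units.val h

end Comparison

end LaurentLoop

/-- `GL_n(A((t))) = GL_n(A[t, t⁻¹]) · GL_n(A⟦t⟧)`: every invertible matrix over the Laurent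
series ring factors as a polynomial loop times a positive loop. -/
theorem GL_laurentSeries_factorization (A : Type*) [CommRing A] (n : ℕ)
    (g : Matrix.GeneralLinearGroup (Fin n)
      (Localization.Away (PowerSeries.X : PowerSeries A))) :
    ∃ (a : Matrix.GeneralLinearGroup (Fin n) (LaurentPolynomial A))
      (b : Matrix.GeneralLinearGroup (Fin n) (PowerSeries A)),
      g = Matrix.GeneralLinearGroup.map (laurentInclusion A) a *
          Matrix.GeneralLinearGroup.map
            (algebraMap (PowerSeries A) (Localization.Away (PowerSeries.X : PowerSeries A)))
            b := by
  obtain ⟨a, ha, b, hb, h⟩ := LaurentLoop.factors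
    (Matrix.GeneralLinearGroup.map (LaurentLoop.awayHom A) g)
  have hψ : (LaurentLoop.awayHom A).comp (algebraMap (PowerSeries A) _) =
      HahnSeries.ofPowerSeries ℤ A := RingHom.ext LaurentLoop.awayHom_algebraMap
  exact LaurentLoop.eq_map_mul_map_of_mem_glSub (LaurentLoop.awayHom_injective A)
    LaurentLoop.laurentPolyLS_injective (fun _ => LaurentLoop.exists_laurentPolyLS_eq)
    (hψ ▸ HahnSeries.ofPowerSeries_injective)
    (hψ ▸ fun _ => LaurentLoop.mem_pos_iff_exists.mp) ha hb h
end

section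
/- Let A be a commutative ring and n a natural number. Every matrix in SL_n(A((t))) (n × n matrices of determinant 1 over the Laurent series ring) factors as SL_n(A((t))) = SL_n(A[t, t⁻¹]) · SL_n(A⟦t⟧): for every g ∈ SL_n(A((t))) there exist a ∈ SL_n(A[t, t⁻¹]) and b ∈ SL_n(A⟦t⟧) such that g equals the product of the images of a and b under the maps induced by the canonical ring homomorphisms A[t, t⁻¹] → A((t)) and A⟦t⟧ → A((t)). -/
section
open LaurentPolynomial PowerSeries LaurentSeries
variable {R : Type*} [CommRing R]

/-- The comparison between the localization of power series away from the variable and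
Mathlib's Laurent series. -/
noncomputable def localizationEquivLaurentSeries (R : Type*) [CommRing R] :
    Localization.Away (PowerSeries.X : R⟦X⟧) ≃ₐ[R⟦X⟧] R⸨X⸩ :=
  IsLocalization.algEquiv (Submonoid.powers (PowerSeries.X : R⟦X⟧)) _ _

/-- The embedding of Laurent polynomials in Laurent series. -/
noncomputable def polyLoop :
    R[T;T⁻¹] →+* R⸨X⸩ :=
  (localizationEquivLaurentSeries R : _ →+* R⸨X⸩).comp (laurentInclusion R)

/-- The embedding of power series in Laurent series. -/
noncomputable abbrev posLoop : R⟦X⟧ →+* R⸨X⸩ :=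
  HahnSeries.ofPowerSeries ℤ R

theorem polyLoop_toLaurent (p : Polynomial R) :
    polyLoop (Polynomial.toLaurent p) =
      posLoop (p : R⟦X⟧) := by
  have := LaurentPolynomial.isLocalization (R := R)
  have h : laurentInclusion R (Polynomial.toLaurent p) = algebraMap R⟦X⟧ _ (p : R⟦X⟧) := by
    rw [← LaurentPolynomial.algebraMap_eq_toLaurent, laurentInclusion]
    exact IsLocalization.Away.lift_eq _ _ _
  simp only [polyLoop, RingHom.comp_apply, h]
  exact (localizationEquivLaurentSeries R).commutes _

theorem polyLoop_T_natCast (n : ℕ) :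
    polyLoop (T n : R[T;T⁻¹]) = posLoop (X ^ n) := by
  rw [← Polynomial.toLaurent_X_pow, polyLoop_toLaurent, Polynomial.coe_pow,
    Polynomial.coe_X]

theorem polyLoop_T (n : ℤ) :
    polyLoop (T n : R[T;T⁻¹]) = HahnSeries.single n 1 := by
  have key (n : ℕ) : polyLoop (T n : R[T;T⁻¹]) = HahnSeries.single (n : ℤ) 1 := by
    rw [polyLoop_T_natCast, HahnSeries.ofPowerSeries_X_pow]
  obtain ⟨n, rfl | rfl⟩ := n.eq_nat_or_neg
  · exact key n
  · have h1 : polyLoop (T (-n) : R[T;T⁻¹]) *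
        polyLoop (T n : R[T;T⁻¹]) = 1 := by
      rw [← map_mul, ← T_add, neg_add_cancel, T_zero, map_one]
    have h2 : HahnSeries.single (n : ℤ) (1 : R) * HahnSeries.single (-n : ℤ) 1 = 1 := by
      rw [HahnSeries.single_mul_single, add_neg_cancel, one_mul]; rfl
    rw [key] at h1
    exact left_inv_eq_right_inv h1 h2

theorem polyLoop_C (r : R) :
    polyLoop (LaurentPolynomial.C r) =
      posLoop (PowerSeries.C r) := by
  rw [← Polynomial.toLaurent_C, polyLoop_toLaurent, Polynomial.coe_C]

theorem exists_toLaurent_eq {f : R[T;T⁻¹]} {u : R⟦X⟧}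
    (h : polyLoop f = posLoop u) :
    ∃ p : Polynomial R, Polynomial.toLaurent p = f := by
  obtain ⟨n, p, hp⟩ := f.exists_T_pow
  have h1 : (p : R⟦X⟧) = u * X ^ n := by
    apply HahnSeries.ofPowerSeries_injective (Γ := ℤ)
    rw [← polyLoop_toLaurent, hp, map_mul, map_mul, h, polyLoop_T_natCast]
  have h2 : (Polynomial.X : Polynomial R) ^ n ∣ p := by
    rw [Polynomial.X_pow_dvd_iff]
    intro d hd
    rw [← Polynomial.coeff_coe, h1, PowerSeries.coeff_mul_X_pow', if_neg hd.not_ge]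
  obtain ⟨q, rfl⟩ := h2
  refine ⟨q, ?_⟩
  rw [map_mul, Polynomial.toLaurent_X_pow, mul_comm] at hp
  exact (isUnit_T (n : ℤ)).mul_left_injective hp

theorem eventually_T_mul_eq (x : R⸨X⸩) : ∀ᶠ N : ℕ in Filter.atTop,
    ∃ u, posLoop u = polyLoop (T N) * x := by
  filter_upwards [Filter.eventually_ge_atTop (-x.order).toNat] with N hN
  refine ⟨X ^ (N + x.order).toNat * x.powerSeriesPart, ?_⟩
  conv_rhs => rw [← x.single_order_mul_powerSeriesPart, ← polyLoop_T, ← mul_assoc,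
    ← map_mul, ← T_add]
  rw [map_mul, ← polyLoop_T_natCast, Int.toNat_of_nonneg (by omega)]

theorem exists_eq_add_T_mul (N : ℕ) (x : R⸨X⸩) : ∃ f u,
    x = polyLoop f +
      polyLoop (T N) * posLoop u := by
  obtain ⟨M, v, hv⟩ := (eventually_T_mul_eq x).exists
  obtain ⟨u, hu⟩ : X ^ (N + M) ∣ v - (v.trunc (N + M) : R⟦X⟧) := by
    rw [X_pow_dvd_iff]
    intro m hm
    rw [map_sub, Polynomial.coeff_coe, coeff_trunc, if_pos hm, sub_self]
  rw [sub_eq_iff_eq_add'] at hu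
  refine ⟨T (-M) * Polynomial.toLaurent (v.trunc (N + M)), u, ?_⟩
  have h1 : x = polyLoop (T (-M)) * posLoop v := by
    rw [hv, ← mul_assoc, ← map_mul, ← T_add, neg_add_cancel, T_zero, map_one, one_mul]
  conv_lhs => rw [h1, hu]
  rw [map_add, map_mul, ← polyLoop_T_natCast, ← polyLoop_toLaurent, mul_add,
    ← mul_assoc, ← map_mul, ← map_mul, ← T_add]
  congr 4
  push_cast
  ring
end

section
open LaurentPolynomial LaurentSeries
variable {R m n k : Type*} [CommRing R]

/-- A matrix of Laurent series is positive when all its entries are power series. -/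
def Matrix.IsPositive (M : Matrix m n R⸨X⸩) : Prop :=
  ∃ U : Matrix m n (PowerSeries R), U.map posLoop = M

namespace Matrix.IsPositive

theorem map_posLoop (U : Matrix m n (PowerSeries R)) : (U.map posLoop).IsPositive := ⟨U, rfl⟩

theorem map_polyLoop (p : Matrix m n (Polynomial R)) :
    ((p.map Polynomial.toLaurent).map polyLoop).IsPositive :=
  ⟨p.map (↑), by ext1 i j; exact (polyLoop_toLaurent _).symm⟩

theorem one [DecidableEq n] : (1 : Matrix n n R⸨X⸩).IsPositive :=
  ⟨1, by simp⟩

theorem add {M N : Matrix m n R⸨X⸩} (hM : M.IsPositive) (hN : N.IsPositive) :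
    (M + N).IsPositive := by
  obtain ⟨U, rfl⟩ := hM
  obtain ⟨V, rfl⟩ := hN
  exact ⟨U + V, Matrix.map_add _ (map_add _) U V⟩

theorem sub {M N : Matrix m n R⸨X⸩} (hM : M.IsPositive) (hN : N.IsPositive) :
    (M - N).IsPositive := by
  obtain ⟨U, rfl⟩ := hM
  obtain ⟨V, rfl⟩ := hN
  exact ⟨U - V, Matrix.map_sub _ (map_sub _) U V⟩

theorem mul [Fintype n] {M : Matrix m n R⸨X⸩} {N : Matrix n k R⸨X⸩} (hM : M.IsPositive)
    (hN : N.IsPositive) : (M * N).IsPositive := by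
  obtain ⟨U, rfl⟩ := hM
  obtain ⟨V, rfl⟩ := hN
  exact ⟨U * V, by rw [Matrix.map_mul]⟩

theorem posLoop_smul {M : Matrix m n R⸨X⸩} (hM : M.IsPositive) (u : PowerSeries R) :
    (posLoop u • M).IsPositive := by
  obtain ⟨U, rfl⟩ := hM
  refine ⟨u • U, ?_⟩
  ext1 i j
  simp

theorem T_smul {M : Matrix m n R⸨X⸩} (hM : M.IsPositive) (N : ℕ) :
    (polyLoop (T N : R[T;T⁻¹]) • M).IsPositive := by
  rw [polyLoop_T_natCast]
  exact hM.posLoop_smul _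

theorem fromRows {M : Matrix m k R⸨X⸩} {N : Matrix n k R⸨X⸩} (hM : M.IsPositive)
    (hN : N.IsPositive) : (M.fromRows N).IsPositive := by
  obtain ⟨U, rfl⟩ := hM
  obtain ⟨V, rfl⟩ := hN
  exact ⟨U.fromRows V, by ext1 i j; rcases i with i | i <;> rfl⟩

theorem fromCols {M : Matrix k m R⸨X⸩} {N : Matrix k n R⸨X⸩} (hM : M.IsPositive)
    (hN : N.IsPositive) : (M.fromCols N).IsPositive := by
  obtain ⟨U, rfl⟩ := hM
  obtain ⟨V, rfl⟩ := hN
  exact ⟨U.fromCols V, by ext1 i j; rcases j with j | j <;> rfl⟩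

theorem exists_toLaurent {P : Matrix m n R[T;T⁻¹]} (h : (P.map polyLoop).IsPositive) :
    ∃ p : Matrix m n (Polynomial R), p.map Polynomial.toLaurent = P := by
  obtain ⟨U, hU⟩ := h
  choose p hp using fun i j => exists_toLaurent_eq (f := P i j) (u := U i j) congr($hU.symm i j)
  exact ⟨Matrix.of p, by ext1 i j; exact hp i j⟩

theorem exists_map_posLoop_eq [Fintype n] [DecidableEq n] {g : SpecialLinearGroup n R⸨X⸩}
    (h : (g : Matrix n n R⸨X⸩).IsPositive) :
    ∃ b : SpecialLinearGroup n (PowerSeries R), SpecialLinearGroup.map posLoop b = g := by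
  obtain ⟨U, hU⟩ := h
  refine ⟨⟨U, HahnSeries.ofPowerSeries_injective (Γ := ℤ) ?_⟩, Subtype.ext hU⟩
  rw [map_one, RingHom.map_det, RingHom.mapMatrix_apply, hU, g.det_coe]

end Matrix.IsPositive

theorem Matrix.eventually_isPositive [Finite m] [Finite n] (M : Matrix m n R⸨X⸩) :
    ∀ᶠ N : ℕ in Filter.atTop, (polyLoop (T N : R[T;T⁻¹]) • M).IsPositive := by
  have h := Filter.eventually_all.mpr fun i => Filter.eventually_all.mpr fun j =>
    eventually_T_mul_eq (M i j)
  filter_upwards [h] with N hN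
  choose U hU using hN
  exact ⟨Matrix.of U, by ext1 i j; exact hU i j⟩

theorem Matrix.exists_eq_add_T_smul (N : ℕ) (M : Matrix m n R⸨X⸩) :
    ∃ (P : Matrix m n R[T;T⁻¹]) (U : Matrix m n R⸨X⸩), U.IsPositive ∧
      M = P.map polyLoop + polyLoop (T N : R[T;T⁻¹]) • U := by
  choose f u h using fun i j => exists_eq_add_T_mul N (M i j)
  exact ⟨Matrix.of f, _, .map_posLoop (Matrix.of u), by ext1 i j; exact h i j⟩
end

section
open Matrix

theorem Matrix.SpecialLinearGroup.diag2n_eq_transvection_mul {ι F : Type*} [Fintype ι]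
    [DecidableEq ι] [Field F] {i j : ι} (hij : i ≠ j) {a : F} (ha : a ≠ 0) :
    diag2n hij a ha = transvection hij a * transvection hij.symm (-a⁻¹) * transvection hij a *
      transvection hij (-1) * transvection hij.symm 1 * transvection hij (-1) := by
  apply Subtype.ext
  simp only [coe_mul, transvection_coe, diag2n_coe, mul_add, add_mul, mul_one, one_mul,
    single_mul_single_same, single_mul_single_of_ne, hij, hij.symm, ne_eq,
    not_false_eq_true, add_zero]
  ext k l
  simp only [Matrix.add_apply, Matrix.single_apply, Matrix.diagonal_apply, Matrix.one_apply]
  by_cases hk : i = k <;> by_cases hl : j = l <;> by_cases hk' : j = k <;> by_cases hl' : i = l <;>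
    by_cases hkl : k = l <;> grind

theorem Matrix.SpecialLinearGroup.closure_transvection_eq_top {ι F : Type*} [Fintype ι]
    [DecidableEq ι] [Nontrivial ι] [Field F] :
    Subgroup.closure {g : SpecialLinearGroup ι F |
      ∃ (i j : ι) (hij : i ≠ j) (a : F), g = transvection hij a} = ⊤ := by
  rw [eq_top_iff]
  rintro M -
  have h {i j : ι} (hij : i ≠ j) (a : F) : transvection hij a ∈ Subgroup.closure
      {g : SpecialLinearGroup ι F | ∃ (i j : ι) (hij : i ≠ j) (a : F), g = transvection hij a} :=
    Subgroup.subset_closure ⟨i, j, hij, a, rfl⟩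
  refine diagonal_transvection_induction' (· ∈ Subgroup.closure _) M (fun i j hij c hc => ?_)
    (fun i j hij a => h hij a) (fun A B => mul_mem)
  rw [diag2n_eq_transvection_mul]
  exact mul_mem (mul_mem (mul_mem (mul_mem (mul_mem (h _ _) (h _ _)) (h _ _)) (h _ _)) (h _ _))
    (h _ _)

theorem Matrix.SpecialLinearGroup.map_transvection {ι B F : Type*} [Fintype ι] [DecidableEq ι]
    [CommRing B] [CommRing F] (f : B →+* F) {i j : ι} (hij : i ≠ j) (b : B) :
    map f (transvection hij b) = transvection hij (f b) := by
  apply Subtype.ext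
  change (transvection hij b).1.map f = _
  simp [transvection_coe, Matrix.map_add]

theorem Matrix.SpecialLinearGroup.exists_mem_closure_transvection_map_eq {ι B F : Type*} [Fintype ι]
    [DecidableEq ι] [Nontrivial ι] [CommRing B] [Field F] {f : B →+* F}
    (hf : Function.Surjective f) (g : SpecialLinearGroup ι F) :
    ∃ x ∈ Subgroup.closure {g : SpecialLinearGroup ι B |
      ∃ (i j : ι) (hij : i ≠ j) (b : B), g = transvection hij b}, map f x = g := by
  rw [← Subgroup.mem_map]
  suffices h : ⊤ ≤ (Subgroup.closure {g : SpecialLinearGroup ι B |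
      ∃ (i j : ι) (hij : i ≠ j) (b : B), g = transvection hij b}).map (map f) from
    h (Subgroup.mem_top g)
  rw [← closure_transvection_eq_top, Subgroup.closure_le]
  rintro - ⟨i, j, hij, a, rfl⟩
  obtain ⟨b, rfl⟩ := hf a
  exact ⟨_, Subgroup.subset_closure ⟨i, j, hij, b, rfl⟩, map_transvection f hij b⟩
end

section
open Matrix LaurentPolynomial LaurentSeries
variable {R n : Type*} [CommRing R] [Fintype n] [DecidableEq n]

theorem Matrix.SpecialLinearGroup.exists_transvection_mul_eq {i j : n} (hij : i ≠ j) (x : R⸨X⸩)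
    (a : SpecialLinearGroup n R[T;T⁻¹]) :
    ∃ (p : SpecialLinearGroup n R[T;T⁻¹]) (q : SpecialLinearGroup n (PowerSeries R)),
      transvection hij x * map polyLoop a = map polyLoop p * map posLoop q := by
  obtain ⟨N, hN⟩ := (Matrix.eventually_isPositive ((map polyLoop a⁻¹).1 *
    Matrix.single i j (1 : R⸨X⸩) * (map polyLoop a).1)).exists
  obtain ⟨f, u, rfl⟩ := exists_eq_add_T_mul N x
  obtain ⟨q, hq⟩ := IsPositive.exists_map_posLoop_eq (g := map polyLoop a⁻¹ *
    transvection hij (polyLoop (T N : R[T;T⁻¹]) * posLoop u) * map polyLoop a) (by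
      have h : ((map polyLoop a⁻¹ * transvection hij (polyLoop (T N : R[T;T⁻¹]) * posLoop u) *
          map polyLoop a : SpecialLinearGroup n R⸨X⸩) : Matrix n n R⸨X⸩) = 1 + posLoop u •
          polyLoop (T N : R[T;T⁻¹]) • ((map polyLoop a⁻¹).1 * Matrix.single i j (1 : R⸨X⸩) *
          (map polyLoop a).1) := by
        have h1 : (map polyLoop a⁻¹).1 * (map polyLoop a).1 = (1 : Matrix n n R⸨X⸩) := by
          rw [← coe_mul, ← map_mul, inv_mul_cancel, map_one, coe_one]
        have h2 : Matrix.single i j (polyLoop (T N : R[T;T⁻¹]) * posLoop u) =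
            (posLoop u * polyLoop (T N : R[T;T⁻¹])) • Matrix.single i j (1 : R⸨X⸩) := by
          rw [Matrix.smul_single, smul_eq_mul, mul_one, mul_comm]
        rw [coe_mul, coe_mul, transvection_coe, h2, Matrix.mul_add, Matrix.add_mul, Matrix.mul_one,
          h1, Matrix.mul_smul, Matrix.smul_mul, mul_smul]
      rw [h]
      exact IsPositive.one.add (hN.posLoop_smul u))
  refine ⟨transvection hij f * a, q, ?_⟩
  rw [hq, map_mul, map_transvection, transvection_add, map_inv]
  group

theorem Matrix.SpecialLinearGroup.exists_eq_of_mem_closure_transvection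
    {g : SpecialLinearGroup n R⸨X⸩} (hg : g ∈ Subgroup.closure {g : SpecialLinearGroup n R⸨X⸩ |
      ∃ (i j : n) (hij : i ≠ j) (b : R⸨X⸩), g = transvection hij b}) :
    ∃ (a : SpecialLinearGroup n R[T;T⁻¹]) (b : SpecialLinearGroup n (PowerSeries R)),
      g = map polyLoop a * map posLoop b := by
  induction hg using Subgroup.closure_induction_left with
  | one => exact ⟨1, 1, by simp⟩
  | mul_left x hx y _ h =>
    obtain ⟨i, j, hij, x, rfl⟩ := hx
    obtain ⟨a, b, rfl⟩ := h
    obtain ⟨p, q, hpq⟩ := exists_transvection_mul_eq hij x a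
    exact ⟨p, q * b, by rw [map_mul, ← mul_assoc, ← mul_assoc, hpq]⟩
  | inv_mul_cancel x hx y _ h =>
    obtain ⟨i, j, hij, x, rfl⟩ := hx
    obtain ⟨a, b, rfl⟩ := h
    obtain ⟨p, q, hpq⟩ := exists_transvection_mul_eq hij (-x) a
    exact ⟨p, q * b, by rw [transvection_inv, map_mul, ← mul_assoc, ← mul_assoc, hpq]⟩

/-- The coefficientwise map of Laurent series. -/
noncomputable def LaurentSeries.mapRingHom {S : Type*} [CommRing S] (f : R →+* S) :
    R⸨X⸩ →+* S⸨X⸩ where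
  toFun x := HahnSeries.map x f
  map_zero' := by ext; simp
  map_one' := HahnSeries.map_one f.toMonoidWithZeroHom
  map_add' _ _ := HahnSeries.map_add (f : R →+ S)
  map_mul' _ _ := HahnSeries.map_mul (f : R →ₙ+* S)

theorem LaurentSeries.mapRingHom_surjective {S : Type*} [CommRing S] {f : R →+* S}
    (hf : Function.Surjective f) : Function.Surjective (LaurentSeries.mapRingHom f) := by
  intro y
  let s : S → R := fun a => open Classical in if a = 0 then 0 else (hf a).choose
  have hs : ∀ a, f (s a) = a := fun a => by
    by_cases ha : a = 0
    · simp [s, ha]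
    · simpa [s, ha] using (hf a).choose_spec
  refine ⟨HahnSeries.map y (⟨s, by simp [s]⟩ : ZeroHom S R), ?_⟩
  ext k
  exact hs (y.coeff k)

theorem Matrix.SpecialLinearGroup.exists_eq_mul_of_isMaximal [Nontrivial n] (I : Ideal R)
    [I.IsMaximal] (g : SpecialLinearGroup n R⸨X⸩) :
    ∃ (a : SpecialLinearGroup n R[T;T⁻¹]) (b : SpecialLinearGroup n (PowerSeries R))
      (k : SpecialLinearGroup n R⸨X⸩), g = map polyLoop a * k * map posLoop b ∧
        map (LaurentSeries.mapRingHom (Ideal.Quotient.mk I)) k = 1 := by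
  let _ : Field (R ⧸ I) := Ideal.Quotient.field I
  obtain ⟨e, he, heg⟩ := exists_mem_closure_transvection_map_eq
    (f := LaurentSeries.mapRingHom (Ideal.Quotient.mk I))
    (LaurentSeries.mapRingHom_surjective Ideal.Quotient.mk_surjective)
    (map (LaurentSeries.mapRingHom (Ideal.Quotient.mk I)) g)
  obtain ⟨a, b, rfl⟩ := exists_eq_of_mem_closure_transvection he
  refine ⟨a, b, map posLoop b * (map polyLoop a * map posLoop b)⁻¹ * g * (map posLoop b)⁻¹, ?_, ?_⟩
  · group
  · rw [map_mul, map_mul, map_mul, map_inv, map_inv, heg]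
    group
end

section
open Matrix LaurentPolynomial LaurentSeries
variable {R n : Type*} [CommRing R]

theorem LaurentPolynomial.exists_eq_invert_toLaurent_add (f : R[T;T⁻¹]) :
    ∃ p q : Polynomial R,
      f = invert (Polynomial.toLaurent (Polynomial.X * p)) + Polynomial.toLaurent q := by
  induction f using LaurentPolynomial.induction_on' with
  | add f g hf hg =>
    obtain ⟨p, q, rfl⟩ := hf
    obtain ⟨p', q', rfl⟩ := hg
    exact ⟨p + p', q + q', by rw [mul_add, map_add, map_add, map_add]; abel⟩
  | C_mul_T k a =>
    rcases lt_or_ge k 0 with hk | hk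
    · obtain ⟨l, rfl⟩ : ∃ l : ℕ, k = -(l + 1) := ⟨(-k - 1).toNat, by omega⟩
      refine ⟨Polynomial.C a * Polynomial.X ^ l, 0, ?_⟩
      rw [map_zero, add_zero, mul_left_comm, ← pow_succ', map_mul, map_mul,
        Polynomial.toLaurent_X_pow, Polynomial.toLaurent_C, invert_C, invert_T]
      push_cast
      rfl
    · lift k to ℕ using hk
      refine ⟨0, Polynomial.C a * Polynomial.X ^ k, ?_⟩
      rw [mul_zero, map_zero, map_zero, zero_add, map_mul, Polynomial.toLaurent_X_pow,
        Polynomial.toLaurent_C]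

theorem Matrix.exists_eq_invert_add_posLoop {m : Type*} (M : Matrix m n R⸨X⸩) :
    ∃ (P : Matrix m n (Polynomial R)) (U : Matrix m n (PowerSeries R)),
      M = (((Polynomial.X : Polynomial R) • P).map fun p => invert (Polynomial.toLaurent p)).map
        polyLoop + U.map posLoop := by
  have h (x : R⸨X⸩) : ∃ (p : Polynomial R) (u : PowerSeries R), x =
      polyLoop (invert (Polynomial.toLaurent (Polynomial.X * p))) + posLoop u := by
    obtain ⟨f, u, rfl⟩ := exists_eq_add_T_mul 0 x
    obtain ⟨p, q, rfl⟩ := f.exists_eq_invert_toLaurent_add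
    refine ⟨p, q + u, ?_⟩
    rw [map_add, map_add, polyLoop_toLaurent, Nat.cast_zero, T_zero, map_one, one_mul, add_assoc]
  choose P U hPU using fun i j => h (M i j)
  exact ⟨Matrix.of P, Matrix.of U, by ext1 i j; exact hPU i j⟩

theorem Polynomial.eq_C_of_invert_eq_posLoop {D : Polynomial R} {u : PowerSeries R}
    (h : polyLoop (invert (Polynomial.toLaurent D)) = posLoop u) :
    D = Polynomial.C (D.coeff 0) := by
  obtain ⟨q, hq⟩ := exists_toLaurent_eq h
  have h1 : D.reverse = q * Polynomial.X ^ D.natDegree := by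
    apply Polynomial.toLaurent_injective
    rw [toLaurent_reverse, map_mul, Polynomial.toLaurent_X_pow, hq]
  apply Polynomial.eq_C_of_natDegree_eq_zero
  by_contra hne
  have h2 : D.leadingCoeff = 0 := by
    rw [← Polynomial.coeff_zero_reverse, h1, Polynomial.mul_coeff_zero,
      Polynomial.coeff_X_pow, if_neg (Ne.symm hne), mul_zero]
  rw [Polynomial.leadingCoeff_eq_zero] at h2
  simp [h2] at hne

/-- The coefficients of `t⁻¹, …, t⁻ᴺ` in the entries of a matrix of Laurent series. -/
def Matrix.polarPart {l : Type*} (N : ℕ) (Z : Matrix n l R⸨X⸩) : Matrix (Fin N × n) l R :=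
  Matrix.of fun k j => (Z k.2 j).coeff (-(k.1 + 1))

theorem Matrix.polarPart_add {l : Type*} (N : ℕ) (Z Z' : Matrix n l R⸨X⸩) :
    (Z + Z').polarPart N = Z.polarPart N + Z'.polarPart N := rfl

theorem Matrix.polarPart_sub {l : Type*} (N : ℕ) (Z Z' : Matrix n l R⸨X⸩) :
    (Z - Z').polarPart N = Z.polarPart N - Z'.polarPart N := by
  ext1 i j
  exact HahnSeries.coeff_sub

theorem Matrix.polarPart_mul_map_C {l r : Type*} [Fintype l] (N : ℕ) (Z : Matrix n l R⸨X⸩)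
    (Y : Matrix l r R) :
    (Z * Y.map (posLoop.comp PowerSeries.C)).polarPart N = Z.polarPart N * Y := by
  ext1 i j
  simp only [polarPart, Matrix.mul_apply, Matrix.of_apply, HahnSeries.coeff_sum, Matrix.map_apply,
    RingHom.comp_apply, HahnSeries.ofPowerSeries_C, HahnSeries.C_apply,
    HahnSeries.coeff_mul_single_zero]

theorem Matrix.polarPart_map_posLoop {l : Type*} (N : ℕ) (U : Matrix n l (PowerSeries R)) :
    (U.map posLoop).polarPart N = 0 := by
  ext1 i j
  change ((U i.2 j : R⸨X⸩)).coeff _ = 0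
  rw [PowerSeries.coeff_coe, if_pos (by omega)]

theorem Matrix.isPositive_of_polarPart_eq_zero {l : Type*} {N : ℕ} {Z : Matrix n l R⸨X⸩}
    (hN : (polyLoop (T N : R[T;T⁻¹]) • Z).IsPositive) (hZ : Z.polarPart N = 0) :
    Z.IsPositive := by
  have h (i : n) (j : l) : ∃ u, posLoop u = Z i j := by
    obtain ⟨U, hU⟩ := hN
    have hU' : posLoop (U i j) = polyLoop (T N : R[T;T⁻¹]) * Z i j := congr($hU i j)
    obtain ⟨u, hu⟩ : PowerSeries.X ^ N ∣ U i j := by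
      rw [PowerSeries.X_pow_dvd_iff]
      intro k hk
      rw [← LaurentSeries.coeff_coe_powerSeries]
      change (posLoop (U i j)).coeff _ = 0
      have h0 : (Z i j).coeff (-((N - 1 - k : ℕ) + 1)) = 0 :=
        congr($hZ (⟨N - 1 - k, by omega⟩, i) j)
      rw [hU', polyLoop_T, HahnSeries.coeff_single_mul, one_mul, ← h0]
      congr 1
      omega
    refine ⟨u, ?_⟩
    rw [hu, map_mul, ← polyLoop_T_natCast] at hU'
    exact (((isUnit_T (R := R) N).map polyLoop)).mul_right_injective hU'
  choose U hU using h
  exact ⟨Matrix.of U, by ext1 i j; exact hU i j⟩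
end

section
open Matrix LaurentPolynomial LaurentSeries
variable {R n : Type*} [CommRing R]

theorem Matrix.map_polarPart {l S : Type*} [CommRing S] (f : R →+* S) (N : ℕ)
    (Z : Matrix n l R⸨X⸩) :
    (Z.polarPart N).map f = (Z.map (LaurentSeries.mapRingHom f)).polarPart N := rfl

variable [DecidableEq n]

/-- The matrix whose columns are the vectors `t⁻⁽ˡ⁺¹⁾ eᵢ` for `l < N`. -/
noncomputable def Matrix.polarBasis (R n : Type*) [CommRing R] [DecidableEq n] (N : ℕ) :
    Matrix n (Fin N × n) R⸨X⸩ :=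
  Matrix.of fun i k => if i = k.2 then polyLoop (T (-(k.1 + 1))) else 0

theorem Matrix.polarPart_polarBasis (N : ℕ) : (polarBasis R n N).polarPart N = 1 := by
  ext1 ⟨a, i⟩ ⟨b, j⟩
  simp only [polarPart, polarBasis, Matrix.of_apply, Matrix.one_apply, Prod.mk.injEq, polyLoop_T]
  rcases eq_or_ne i j with rfl | hij
  · simp [HahnSeries.coeff_single, Fin.ext_iff]
  · simp [hij]

theorem Matrix.isPositive_T_smul_polarBasis (N : ℕ) :
    (polyLoop (T N : R[T;T⁻¹]) • polarBasis R n N).IsPositive := by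
  refine ⟨Matrix.of fun i k => if i = k.2 then PowerSeries.X ^ (N - 1 - k.1 : ℕ) else 0, ?_⟩
  ext1 i ⟨b, j⟩
  simp only [polarBasis, Matrix.map_apply, Matrix.of_apply, Matrix.smul_apply, smul_eq_mul]
  split_ifs
  · rw [← polyLoop_T_natCast, ← map_mul, ← T_add]
    congr 2
    omega
  · simp

variable [Fintype n]

theorem Matrix.SpecialLinearGroup.exists_mul_posLoop_eq_polyLoop (I : Ideal R) [I.IsPrime]
    (k : SpecialLinearGroup n R⸨X⸩)
    (hk : map (LaurentSeries.mapRingHom (Ideal.Quotient.mk I)) k = 1) :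
    ∃ d ∉ I, ∃ (V : Matrix n n (PowerSeries R)) (W : Matrix n n R[T;T⁻¹]),
      (k : Matrix n n R⸨X⸩) * V.map posLoop = W.map polyLoop ∧ W.det = LaurentPolynomial.C d := by
  set h : Matrix n n R⸨X⸩ := ((k⁻¹ : SpecialLinearGroup n R⸨X⸩) : Matrix n n R⸨X⸩) with hh
  have hkh : (k : Matrix n n R⸨X⸩) * h = 1 := by rw [hh, ← coe_mul, mul_inv_cancel, coe_one]
  have hhI : h.map (LaurentSeries.mapRingHom (Ideal.Quotient.mk I)) = 1 := by
    change (map (LaurentSeries.mapRingHom (Ideal.Quotient.mk I)) k⁻¹).1 = 1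
    rw [map_inv, hk, inv_one]
    rfl
  obtain ⟨N, hN⟩ := (Matrix.eventually_isPositive h).exists
  obtain ⟨P, U, hPU⟩ := ((k : Matrix n n R⸨X⸩) * polarBasis R n N).exists_eq_invert_add_posLoop
  set M := (h * U.map posLoop).polarPart N with hM
  have hMI : M.map (Ideal.Quotient.mk I) = 0 := by
    rw [hM, Matrix.map_polarPart, Matrix.map_mul, hhI, Matrix.one_mul, ← Matrix.map_polarPart,
      Matrix.polarPart_map_posLoop]
    exact Matrix.map_zero _ (map_zero _)
  set δ := (1 - M).det with hδ
  have hδI : Ideal.Quotient.mk I δ = 1 := by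
    rw [hδ, RingHom.map_det, map_sub, map_one, RingHom.mapMatrix_apply, hMI, sub_zero, det_one]
  set Y := (1 - M).adjugate * h.polarPart N with hY
  have hMY : M * Y - Y = -(δ • h.polarPart N) := by
    rw [hY, ← Matrix.mul_assoc, ← Matrix.sub_mul, ← sub_one_mul, ← neg_sub 1 M, Matrix.neg_mul,
      Matrix.mul_adjugate, Matrix.neg_mul, Matrix.smul_mul, Matrix.one_mul]
  set κY := Y.map (posLoop.comp PowerSeries.C) with hκY
  have hκYp : κY.IsPositive := ⟨Y.map PowerSeries.C, rfl⟩
  obtain ⟨V, hV⟩ : (h * (posLoop (PowerSeries.C δ) • 1 + U.map posLoop * κY) -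
      polarBasis R n N * κY).IsPositive := by
    apply Matrix.isPositive_of_polarPart_eq_zero (N := N)
    · rw [smul_sub, ← Matrix.smul_mul, ← Matrix.smul_mul]
      exact (hN.mul ((IsPositive.one.posLoop_smul _).add ((IsPositive.map_posLoop U).mul hκYp))).sub
        ((Matrix.isPositive_T_smul_polarBasis N).mul hκYp)
    · have h1 : (posLoop (PowerSeries.C δ) • 1 : Matrix n n R⸨X⸩) =
          (δ • 1 : Matrix n n R).map (posLoop.comp PowerSeries.C) := by
        ext1 i j
        rcases eq_or_ne i j with rfl | hij <;> simp [*]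
      rw [Matrix.polarPart_sub, Matrix.mul_add, Matrix.polarPart_add, ← Matrix.mul_assoc, hκY,
        Matrix.polarPart_mul_map_C, Matrix.polarPart_mul_map_C, h1, Matrix.polarPart_mul_map_C,
        Matrix.polarPart_polarBasis, ← hM, Matrix.one_mul, add_sub_assoc, hMY, Matrix.mul_smul,
        Matrix.mul_one, add_neg_cancel]
  let ψ : Polynomial R →+* R[T;T⁻¹] :=
    (invert : R[T;T⁻¹] ≃ₐ[R] R[T;T⁻¹]).toRingEquiv.toRingHom.comp
      (Polynomial.toLaurent : Polynomial R →+* R[T;T⁻¹])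
  have hψC (r : R) : polyLoop (ψ (Polynomial.C r)) = posLoop (PowerSeries.C r) := by
    rw [← polyLoop_C]
    simp [ψ]
  set W : Matrix n n (Polynomial R) := Polynomial.C δ • 1 -
    ((Polynomial.X : Polynomial R) • P) * Y.map Polynomial.C with hW
  have hWV : (k : Matrix n n R⸨X⸩) * V.map posLoop = (W.map ψ).map polyLoop := by
    have h2 : (W.map ψ).map polyLoop = posLoop (PowerSeries.C δ) • 1 -
        (((Polynomial.X : Polynomial R) • P).map ψ).map polyLoop * κY := by
      rw [← hψC, hκY]
      have h3 : Y.map (posLoop.comp PowerSeries.C) = ((Y.map Polynomial.C).map ψ).map polyLoop := by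
        ext1 i j
        exact (hψC _).symm
      rw [h3, ← Matrix.map_mul, ← Matrix.map_mul, hW]
      ext1 i j
      simp only [Matrix.map_apply, Matrix.sub_apply, Matrix.smul_apply, smul_eq_mul, map_sub,
        map_mul, Matrix.one_apply, apply_ite ψ, apply_ite polyLoop, map_one, map_zero]
    rw [h2, hV, Matrix.mul_sub, ← Matrix.mul_assoc, ← Matrix.mul_assoc, hkh, Matrix.one_mul, hPU,
      Matrix.add_mul, add_sub_add_right_eq_sub]
    rfl
  have hdet : polyLoop (ψ W.det) = posLoop V.det := by
    have h4 := congrArg Matrix.det hWV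
    rw [det_mul, k.det_coe, one_mul] at h4
    rw [RingHom.map_det, RingHom.map_det, RingHom.map_det]
    exact h4.symm
  have hc : W.det.coeff 0 = δ ^ Fintype.card n := by
    have h5 : W.map Polynomial.constantCoeff = δ • 1 := by
      ext1 i j
      rcases eq_or_ne i j with rfl | hij <;> simp [Matrix.mul_apply, *]
    rw [← Polynomial.constantCoeff_apply, RingHom.map_det, RingHom.mapMatrix_apply, h5, det_smul,
      det_one, mul_one]
  refine ⟨δ ^ Fintype.card n, fun hmem => ?_, V, W.map ψ, hWV, ?_⟩
  · have h6 := Ideal.Quotient.eq_zero_iff_mem.mpr hmem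
    rw [map_pow, hδI, one_pow] at h6
    exact one_ne_zero h6
  · rw [← RingHom.mapMatrix_apply, ← RingHom.map_det, Polynomial.eq_C_of_invert_eq_posLoop hdet, hc]
    simp [ψ]

theorem Matrix.SpecialLinearGroup.exists_isPositive_of_isMaximal [Nontrivial n] (I : Ideal R)
    [I.IsMaximal] (g : SpecialLinearGroup n R⸨X⸩) :
    ∃ d ∉ I, ∃ α β : Matrix n n R[T;T⁻¹], α * β = LaurentPolynomial.C d • 1 ∧
      β * α = LaurentPolynomial.C d • 1 ∧
      (β.map polyLoop * (g : Matrix n n R⸨X⸩)).IsPositive ∧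
      (((g⁻¹ : SpecialLinearGroup n R⸨X⸩) : Matrix n n R⸨X⸩) * α.map polyLoop).IsPositive := by
  obtain ⟨a, b, k, rfl, hk⟩ := exists_eq_mul_of_isMaximal I g
  obtain ⟨d, hd, V, W, hVW, hW⟩ := exists_mul_posLoop_eq_polyLoop I k hk
  have hki : ((k⁻¹ : SpecialLinearGroup n R⸨X⸩) : Matrix n n R⸨X⸩) * k = 1 := by
    rw [← coe_mul, inv_mul_cancel, coe_one]
  have ha : ((a⁻¹ : SpecialLinearGroup n R[T;T⁻¹]) : Matrix n n R[T;T⁻¹]) * a = 1 := by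
    rw [← coe_mul, inv_mul_cancel, coe_one]
  have ha' : (a : Matrix n n R[T;T⁻¹]) * (a⁻¹ : SpecialLinearGroup n R[T;T⁻¹]) = 1 := by
    rw [← coe_mul, mul_inv_cancel, coe_one]
  refine ⟨d, hd, a * W, W.adjugate * (a⁻¹ : SpecialLinearGroup n R[T;T⁻¹]), ?_, ?_, ?_, ?_⟩
  · rw [Matrix.mul_assoc, ← Matrix.mul_assoc W, mul_adjugate, hW, Matrix.smul_mul, Matrix.one_mul,
      Matrix.mul_smul, ha']
  · rw [Matrix.mul_assoc, ← Matrix.mul_assoc _ _ W, ha, Matrix.one_mul, adjugate_mul, hW]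
  · have h1 : W.adjugate.map polyLoop * (k : Matrix n n R⸨X⸩) = V.adjugate.map posLoop := by
      rw [← RingHom.mapMatrix_apply, RingHom.map_adjugate, RingHom.mapMatrix_apply, ← hVW,
        adjugate_mul_distrib, Matrix.mul_assoc, adjugate_mul, k.det_coe, one_smul, Matrix.mul_one,
        ← RingHom.mapMatrix_apply, ← RingHom.map_adjugate, RingHom.mapMatrix_apply]
    have h2 : (W.adjugate * (a⁻¹ : SpecialLinearGroup n R[T;T⁻¹])).map polyLoop *
        ((map polyLoop a * k * map posLoop b : SpecialLinearGroup n R⸨X⸩) : Matrix n n R⸨X⸩) =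
        (V.adjugate * (b : Matrix n n (PowerSeries R))).map posLoop := by
      rw [Matrix.map_mul, Matrix.map_mul, ← h1, coe_mul, coe_mul]
      have h3 : ((a⁻¹ : SpecialLinearGroup n R[T;T⁻¹]) : Matrix n n R[T;T⁻¹]).map polyLoop *
          (map polyLoop a : SpecialLinearGroup n R⸨X⸩) = 1 := by
        rw [map_apply_coe, RingHom.mapMatrix_apply, ← Matrix.map_mul, ha]
        simp
      simp only [Matrix.mul_assoc]
      rw [← Matrix.mul_assoc (Matrix.map _ _) (map polyLoop a : Matrix n n R⸨X⸩), h3,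
        Matrix.one_mul]
      rfl
    rw [h2]
    exact .map_posLoop _
  · have h2 : (((map polyLoop a * k * map posLoop b)⁻¹ : SpecialLinearGroup n R⸨X⸩) :
        Matrix n n R⸨X⸩) * ((a : Matrix n n R[T;T⁻¹]) * W).map polyLoop =
        (((b⁻¹ : SpecialLinearGroup n (PowerSeries R)) : Matrix n n (PowerSeries R)) * V).map
          posLoop := by
      have h3 : ((map polyLoop a * k * map posLoop b)⁻¹ : SpecialLinearGroup n R⸨X⸩) =
          map posLoop b⁻¹ * k⁻¹ * (map polyLoop a)⁻¹ := by
        rw [map_inv]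
        group
      have h4 : (((map polyLoop a)⁻¹ : SpecialLinearGroup n R⸨X⸩) : Matrix n n R⸨X⸩) *
          (a : Matrix n n R[T;T⁻¹]).map polyLoop = 1 := by
        change _ * ((map polyLoop a : SpecialLinearGroup n R⸨X⸩) : Matrix n n R⸨X⸩) = 1
        rw [← coe_mul, inv_mul_cancel, coe_one]
      rw [h3, coe_mul, coe_mul, Matrix.map_mul, Matrix.mul_assoc,
        ← Matrix.mul_assoc _ (Matrix.map _ _), h4, Matrix.one_mul, ← hVW, Matrix.mul_assoc,
        ← Matrix.mul_assoc _ _ (V.map _), hki, Matrix.one_mul, Matrix.map_mul]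
      rfl
    rw [h2]
    exact .map_posLoop _
end

open Polynomial Matrix in
theorem semiconj_of_divided_differences {B M : Type*} [CommRing B] [Ring M] [Algebra B M]
    {T T' E E' E₁ D F : M} {d w : B} (hT : T * T = d • (1 : M))
    (hD : T' = T + (d * w) • D) (hF : E' = E + (d * w) • F) (hTD : T * D + D * T' = 0)
    (hED : E' * D + F * T = D * E₁) (hTE : T * E = E₁ * T) :
    (1 + w • (D * T)) * (1 - w • (D * T')) = 1 ∧
      (1 + w • (D * T)) * E = E' * (1 + w • (D * T)) := by
  have h1 : D * T' = - (T * D) := by rw [eq_neg_iff_add_eq_zero, add_comm, hTD]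
  constructor
  · have h2 : D * T * (D * T') = - (d • (D * D)) := by
      rw [h1, mul_neg, mul_assoc, ← mul_assoc T T D, hT, smul_mul_assoc, one_mul, mul_smul_comm]
    have h3 : D * T' = D * T + (d * w) • (D * D) := by rw [hD, mul_add, mul_smul_comm]
    rw [add_mul, one_mul, mul_sub, mul_one, smul_mul_smul_comm, h2, h3]
    module
  · have h2 : E' * (D * T) = D * (T * E) - d • F := by
      rw [hTE, ← mul_assoc, ← mul_assoc, ← hED, add_mul, mul_assoc F, hT, mul_smul_comm, mul_one]
      abel
    rw [mul_add, mul_smul_comm, h2, hF, add_mul, one_mul, mul_one, smul_mul_assoc, mul_assoc]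
    module

section
open Polynomial Matrix
theorem Matrix.X_smul_injective {B m : Type*} [CommRing B] {M N : Matrix m m B[X]}
    (h : (X : B[X]) • M = (X : B[X]) • N) :
    M = N := by
  ext1 i j
  have h' : X * M i j = X * N i j := congr($h i j)
  ext k
  simpa using congr(coeff $h' (k + 1))

variable {R B m : Type*} [CommRing R] [CommRing B] [Algebra R B] [Fintype m] [DecidableEq m]

theorem Matrix.exists_map_aeval_add_X (M : Matrix m m R[X]) (b : B) :
    ∃ D : Matrix m m B[X], (aeval (C b + X : B[X])).mapMatrix M =
      C.mapMatrix ((aeval b).mapMatrix M) + (X : B[X]) • D := by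
  have h : ∀ p : R[X], ∃ q : B[X], aeval (C b + X : B[X]) p = C (aeval b p) + X * q := by
    intro p
    have hdvd : (X : B[X]) ∣ aeval (C b + X : B[X]) p - C (aeval b p) := by
      have hcomp : ((aeval (0 : B)).restrictScalars R).comp (aeval (C b + X : B[X])) =
          aeval (R := R) b := by
        ext; simp
      rw [X_dvd_iff, coeff_zero_eq_eval_zero, eval_sub, eval_C, sub_eq_zero]
      simpa [coe_aeval_eq_eval] using congr($hcomp p)
    obtain ⟨q, hq⟩ := hdvd
    exact ⟨q, by rw [← hq]; ring⟩
  choose D hD using fun i j => h (M i j)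
  exact ⟨Matrix.of D, by ext1 i j; simp [hD]⟩

theorem Matrix.mapMatrix_aeval_map_C (M : Matrix m m R) (b : B) :
    (aeval b).mapMatrix (M.map C) = (algebraMap R B).mapMatrix M := by
  ext1 i j
  simp

theorem Matrix.mapMatrix_aeval_C_smul_one (d : R) (b : B) :
    (aeval b).mapMatrix (C d • (1 : Matrix m m R[X])) =
      algebraMap R B d • (1 : Matrix m m B) := by
  ext1 i j
  rcases eq_or_ne i j with rfl | hij
  · simp
  · simp [Matrix.one_apply_ne hij]

theorem Matrix.isConj_aeval_add_smul {E T : Matrix m m R[X]} {E₁ : Matrix m m R} {d : R}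
    (hT : T * T = C d • (1 : Matrix m m R[X]))
    (hTE : T * E = E₁.map C * T) (hET : E * T = T * E₁.map C) (b w : B) :
    IsConj ((aeval b).mapMatrix E) ((aeval (b + d • w)).mapMatrix E) := by
  obtain ⟨D, hD⟩ := T.exists_map_aeval_add_X b
  obtain ⟨F, hF⟩ := E.exists_map_aeval_add_X b
  have hev : ∀ M : Matrix m m R[X], (evalRingHom (d • w)).mapMatrix
      ((aeval (C b + X : B[X])).mapMatrix M) = (aeval (b + d • w)).mapMatrix M := by
    intro M
    ext1 i j
    have hcomp : ((aeval (d • w)).restrictScalars R).comp (aeval (C b + X : B[X])) =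
        aeval (R := R) (b + d • w) := by
      ext; simp
    simpa [coe_aeval_eq_eval] using congr($hcomp (M i j))
  have hevC : ∀ M : Matrix m m B, (evalRingHom (d • w)).mapMatrix (C.mapMatrix M) = M := by
    intro M
    ext1 i j
    simp
  have hevX : ∀ M : Matrix m m B[X], (evalRingHom (d • w)).mapMatrix ((X : B[X]) • M) =
      (d • w) • (evalRingHom (d • w)).mapMatrix M := by
    intro M
    ext1 i j
    simp
  have hT₀ := congr((aeval b).mapMatrix $hT)
  have hET₀ := congr(C.mapMatrix ((aeval b).mapMatrix $hET))
  have hTE₀ := congr((aeval b).mapMatrix $hTE)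
  have hTT₀ := congr(C.mapMatrix ((aeval b).mapMatrix $hT))
  have hT' := congr((aeval (C b + X : B[X])).mapMatrix $hT)
  have hET' := congr((aeval (C b + X : B[X])).mapMatrix $hET)
  simp only [map_mul, mapMatrix_aeval_map_C,
    mapMatrix_aeval_C_smul_one] at hT₀ hET₀ hTE₀ hTT₀ hT' hET'
  have hC₁ : C.mapMatrix ((algebraMap R B).mapMatrix E₁) = (algebraMap R B[X]).mapMatrix E₁ := by
    ext1 i j
    simp [Polynomial.algebraMap_apply]
  have hCd : C.mapMatrix (algebraMap R B d • (1 : Matrix m m B)) =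
      algebraMap R B[X] d • (1 : Matrix m m B[X]) := by
    ext1 i j
    rcases eq_or_ne i j with rfl | hij
    · simp [Algebra.algebraMap_eq_smul_one, ← Polynomial.smul_C]
    · simp [Matrix.one_apply_ne hij]
  rw [hC₁] at hET₀
  rw [hCd] at hTT₀
  have hevT := hev T
  have hevE := hev E
  rw [hD, map_add, hevC, hevX] at hevT
  rw [hF, map_add, hevC, hevX] at hevE
  have hTD := X_smul_injective (M := C.mapMatrix ((aeval b).mapMatrix T) * D +
      D * (aeval (C b + X : B[X])).mapMatrix T) (N := 0) (by
    rw [smul_zero, smul_add, ← mul_smul_comm, ← smul_mul_assoc,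
      ← sub_eq_of_eq_add' hD, mul_sub, sub_mul, hTT₀, hT']
    abel)
  have hED := X_smul_injective (M := (aeval (C b + X : B[X])).mapMatrix E * D +
      F * C.mapMatrix ((aeval b).mapMatrix T)) (N := D * (algebraMap R B[X]).mapMatrix E₁) (by
    rw [smul_add, ← mul_smul_comm, ← smul_mul_assoc, ← smul_mul_assoc,
      ← sub_eq_of_eq_add' hD, ← sub_eq_of_eq_add' hF, mul_sub, sub_mul, sub_mul, hET₀, hET']
    abel)
  replace hTD := congr((evalRingHom (d • w)).mapMatrix $hTD)
  replace hED := congr((evalRingHom (d • w)).mapMatrix $hED)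
  rw [← hC₁] at hED
  simp only [map_add, map_mul, map_zero, hev, hevC] at hTD hED
  obtain ⟨h1, h2⟩ := semiconj_of_divided_differences (w := w) hT₀
    (by rw [← Algebra.smul_def]; exact hevT.symm) (by rw [← Algebra.smul_def]; exact hevE.symm)
    hTD hED hTE₀
  exact ⟨⟨_, _, h1, mul_eq_one_comm.mp h1⟩, h2⟩

theorem Matrix.isConj_eval_one {E : Matrix m m R[X]}
    (h : ∀ I : Ideal R, I.IsMaximal → ∃ d ∉ I, ∃ (T : Matrix m m R[X]) (E₁ : Matrix m m R),
      T * T = C d • (1 : Matrix m m R[X]) ∧ T * E = E₁.map C * T ∧ E * T = T * E₁.map C) :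
    IsConj ((E.map (eval 1)).map C) E := by
  let J : Ideal R :=
    { carrier := {s | ∀ b w : R[X],
        IsConj ((aeval b).mapMatrix E) ((aeval (b + s • w)).mapMatrix E)}
      zero_mem' := fun b w => by simp [IsConj.refl]
      add_mem' := fun {s t} hs ht b w => by
        rw [add_smul, ← add_assoc]
        exact (hs b w).trans (ht _ w)
      smul_mem' := fun c s hs b w => by
        rw [smul_eq_mul, mul_comm, mul_smul]
        exact hs b (c • w) }
  have hJ : J = ⊤ := by
    by_contra hne
    obtain ⟨I, hI, hJI⟩ := Ideal.exists_le_maximal J hne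
    obtain ⟨d, hd, T, E₁, h1, h2, h3⟩ := h I hI
    exact hd (hJI fun b w => isConj_aeval_add_smul h1 h2 h3 b w)
  have h1 : (1 : R) ∈ J := hJ ▸ Submodule.mem_top
  have key := h1 1 (X - 1)
  have e1 : (aeval (1 : R[X])).mapMatrix E = (E.map (eval 1)).map C := by
    ext1 i j
    have : aeval (1 : R[X]) = (Algebra.ofId R R[X]).comp (aeval (1 : R)) := by ext; simp
    simp [this, Algebra.ofId_apply, coe_aeval_eq_eval]
  have e2 : (aeval (1 + (1 : R) • (X - 1) : R[X])).mapMatrix E = E := by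
    ext1 i j
    simp
  rwa [e1, e2] at key
end

section
open Matrix LaurentPolynomial
variable {R m n : Type*} [CommRing R] [Fintype m] [DecidableEq m] [Fintype n] [DecidableEq n]

theorem LaurentPolynomial.exists_ringHom_toLaurent_eq_eval_one :
    ∃ ev : R[T;T⁻¹] →+* R, ∀ p : Polynomial R, ev (Polynomial.toLaurent p) = p.eval 1 := by
  refine ⟨eval₂ (RingHom.id R) 1, fun p => ?_⟩
  rw [eval₂_toLaurent]
  simp

theorem Matrix.map_toLaurent_C_smul {k l : Type*} (d : R) (M : Matrix k l (Polynomial R)) :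
    (Polynomial.C d • M).map Polynomial.toLaurent = C d • M.map Polynomial.toLaurent := by
  ext1 i j
  simp

theorem Matrix.isConj_of_idempotent_factorization {S : Matrix m n R[T;T⁻¹]}
    {Q : Matrix n m R[T;T⁻¹]} (hQS : Q * S = 1) {e : Matrix m m (Polynomial R)}
    (he : e.map Polynomial.toLaurent = S * Q)
    (h : ∀ I : Ideal R, I.IsMaximal → ∃ d ∉ I, ∃ α β : Matrix n n R[T;T⁻¹],
      α * β = C d • (1 : Matrix n n R[T;T⁻¹]) ∧ β * α = C d • (1 : Matrix n n R[T;T⁻¹]) ∧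
      ∃ (U : Matrix m n (Polynomial R)) (U' : Matrix n m (Polynomial R)),
        U.map Polynomial.toLaurent = S * α ∧ U'.map Polynomial.toLaurent = β * Q) :
    IsConj (((fromBlocks e 0 0 0 : Matrix (m ⊕ n) (m ⊕ n) (Polynomial R)).map
      (Polynomial.eval 1)).map Polynomial.C) (fromBlocks e 0 0 0) := by
  refine isConj_eval_one fun I hI => ?_
  obtain ⟨d, hd, α, β, hαβ, hβα, U, U', hU, hU'⟩ := h I hI
  have heU : e * U = U := Matrix.map_injective Polynomial.toLaurent_injective <| by
    simp only [Matrix.map_mul, he, hU]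
    rw [Matrix.mul_assoc, ← Matrix.mul_assoc Q, hQS, Matrix.one_mul]
  have hU'e : U' * e = U' := Matrix.map_injective Polynomial.toLaurent_injective <| by
    simp only [Matrix.map_mul, he, hU']
    rw [Matrix.mul_assoc, ← Matrix.mul_assoc Q, hQS, Matrix.one_mul]
  have hUU' : U * U' = Polynomial.C d • e :=
    Matrix.map_injective Polynomial.toLaurent_injective <| by
      simp only [Matrix.map_mul, he, hU', hU, map_toLaurent_C_smul]
      rw [Matrix.mul_assoc, ← Matrix.mul_assoc α, hαβ, Matrix.smul_mul, Matrix.one_mul,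
        Matrix.mul_smul]
  have hU'U : U' * U = Polynomial.C d • (1 : Matrix n n (Polynomial R)) :=
    Matrix.map_injective Polynomial.toLaurent_injective <| by
      simp only [Matrix.map_mul, hU', hU, map_toLaurent_C_smul]
      rw [Matrix.mul_assoc, ← Matrix.mul_assoc Q, hQS, Matrix.one_mul, hβα,
        Matrix.map_one _ (map_zero _) (map_one _)]
  have hee : e * e = e := Matrix.map_injective Polynomial.toLaurent_injective <| by
    simp only [Matrix.map_mul, he]
    rw [Matrix.mul_assoc, ← Matrix.mul_assoc Q, hQS, Matrix.one_mul]
  have hE₁ : (fromBlocks 0 0 0 1 : Matrix (m ⊕ n) (m ⊕ n) R).map Polynomial.C =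
      fromBlocks 0 0 0 1 := by
    simp [fromBlocks_map]
  refine ⟨d * d, fun hdd => (hI.isPrime.mem_or_mem hdd).elim hd hd,
    fromBlocks (Polynomial.C d • (1 - e)) U (Polynomial.C d • U') 0, fromBlocks 0 0 0 1,
    ?_, ?_, ?_⟩
  · rw [fromBlocks_multiply, ← fromBlocks_one, fromBlocks_smul]
    congr 1
    · simp only [Matrix.smul_mul, Matrix.mul_smul, hUU', sub_mul, mul_sub, hee, mul_one, one_mul]
      rw [map_mul, mul_smul]
      module
    · simp [heU, Matrix.sub_mul]
    · simp [hU'e, Matrix.mul_sub]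
    · simp [hU'U, mul_smul]
  · rw [hE₁, fromBlocks_multiply, fromBlocks_multiply]
    simp [sub_mul, hee, hU'e]
  · rw [hE₁, fromBlocks_multiply, fromBlocks_multiply]
    simp [mul_sub, hee, heU]

theorem Matrix.exists_factorization_of_isConj {S : Matrix m n R[T;T⁻¹]}
    {Q : Matrix n m R[T;T⁻¹]} (hQS : Q * S = 1) {e : Matrix m m (Polynomial R)}
    (he : e.map Polynomial.toLaurent = S * Q)
    (h : IsConj (((fromBlocks e 0 0 0 : Matrix (m ⊕ n) (m ⊕ n) (Polynomial R)).map
      (Polynomial.eval 1)).map Polynomial.C) (fromBlocks e 0 0 0)) :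
    ∃ (σ : Matrix m n (Polynomial R)) (τ : Matrix n m (Polynomial R)),
      (Q * σ.map Polynomial.toLaurent) * (τ.map Polynomial.toLaurent * S) = 1 := by
  obtain ⟨ev, hev⟩ := exists_ringHom_toLaurent_eq_eval_one (R := R)
  obtain ⟨c, hc⟩ := h
  have he₁ : (e.map (Polynomial.eval 1)).map Polynomial.C =
      (S.map ev).map Polynomial.C * (Q.map ev).map Polynomial.C := by
    rw [← Matrix.map_mul, ← Matrix.map_mul, ← he]
    ext1 i j
    simp [hev]
  have hee : (c : Matrix (m ⊕ n) (m ⊕ n) (Polynomial R)).toBlocks₁₁ *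
      ((e.map (Polynomial.eval 1)).map Polynomial.C) *
      ((c⁻¹ : Units _) : Matrix (m ⊕ n) (m ⊕ n) (Polynomial R)).toBlocks₁₁ = e := by
    have h1 := c.mul_inv_eq_iff_eq_mul.mpr hc.eq
    rw [← Matrix.fromBlocks_toBlocks (c : Matrix (m ⊕ n) (m ⊕ n) (Polynomial R)),
      ← Matrix.fromBlocks_toBlocks ((c⁻¹ : Units _) : Matrix (m ⊕ n) (m ⊕ n) (Polynomial R)),
      fromBlocks_map, fromBlocks_map, fromBlocks_multiply, fromBlocks_multiply] at h1
    simpa using congr(toBlocks₁₁ $h1)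
  refine ⟨(c : Matrix (m ⊕ n) (m ⊕ n) (Polynomial R)).toBlocks₁₁ *
    (S.map ev).map Polynomial.C, (Q.map ev).map Polynomial.C *
    ((c⁻¹ : Units _) : Matrix (m ⊕ n) (m ⊕ n) (Polynomial R)).toBlocks₁₁, ?_⟩
  rw [Matrix.mul_assoc, ← Matrix.mul_assoc (Matrix.map _ _), ← Matrix.map_mul, Matrix.mul_assoc,
    ← Matrix.mul_assoc ((S.map ev).map _), ← he₁,
    ← Matrix.mul_assoc (toBlocks₁₁ _), hee, he, Matrix.mul_assoc,
    hQS, Matrix.mul_one, hQS]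
end

theorem smul_one_sub_mul_mul_eq {B M : Type*} [CommRing B] [Ring M] [Algebra B M] {g h r s : M}
    {x y z : B} (hhg : h * g = 1) (hzx : z * x = 1) :
    (z • (1 - (g - x • r) * (h - (y * y * x) • s))) * g =
      r + (y • g) * s * (y • g) - (y * x) • (r * s * (y • g)) := by
  simp only [sub_mul, mul_sub, smul_mul_assoc, mul_smul_comm, one_mul, mul_assoc, hhg, mul_one]
  linear_combination (norm := module) hzx • (r + (y * y) • (g * (s * g)) -
    (y * y * x) • (r * (s * g)))

section
open Matrix LaurentPolynomial LaurentSeries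
variable {R n : Type*} [CommRing R] [Fintype n] [DecidableEq n]

theorem Matrix.exists_left_inverse_isPositive {g h : Matrix n n R⸨X⸩} (hhg : h * g = 1) :
    ∃ (S : Matrix (n ⊕ n) n R[T;T⁻¹]) (Q : Matrix n (n ⊕ n) R[T;T⁻¹]), Q * S = 1 ∧
      (S.map polyLoop * g).IsPositive ∧ (h * Q.map polyLoop).IsPositive := by
  have hgh : g * h = 1 := mul_eq_one_comm.mp hhg
  obtain ⟨N, hN⟩ := (eventually_isPositive h).exists
  obtain ⟨M, hM⟩ := (eventually_isPositive g).exists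
  obtain ⟨p, r, hr, hp⟩ := exists_eq_add_T_smul N g
  obtain ⟨q, s, hs, hq⟩ := exists_eq_add_T_smul (2 * M + N) h
  have hp' : p.map polyLoop = g - polyLoop (T N : R[T;T⁻¹]) • r := eq_sub_of_add_eq hp.symm
  have hq' : q.map polyLoop = h - polyLoop (T (2 * M + N : ℕ) : R[T;T⁻¹]) • s :=
    eq_sub_of_add_eq hq.symm
  have hsmul (a : R[T;T⁻¹]) (A : Matrix n n R[T;T⁻¹]) :
      (a • A).map polyLoop = polyLoop a • A.map polyLoop := by
    ext1 i j
    simp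
  have hqg : (q.map polyLoop * g).IsPositive := by
    have : q.map polyLoop * g = 1 - polyLoop (T (M + N : ℕ) : R[T;T⁻¹]) •
        (s * (polyLoop (T M : R[T;T⁻¹]) • g)) := by
      rw [hq', sub_mul, hhg, smul_mul_assoc, mul_smul_comm, smul_smul, ← map_mul, ← T_add]
      congr 5
      ring
    rw [this]
    exact IsPositive.one.sub ((hs.mul hM).T_smul _)
  refine ⟨fromRows q ((T (-N) : R[T;T⁻¹]) • (1 - p * q)), fromCols p ((T N : R[T;T⁻¹]) • 1),
    ?_, ?_, ?_⟩
  · rw [fromCols_mul_fromRows, smul_mul_smul_comm, ← T_add, add_neg_cancel, T_zero, one_mul,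
      one_smul, add_sub_cancel]
  · have hmap : (fromRows q ((T (-N) : R[T;T⁻¹]) • (1 - p * q))).map polyLoop =
        fromRows (q.map polyLoop) (((T (-N) : R[T;T⁻¹]) • (1 - p * q)).map polyLoop) := by
      ext1 i j
      rcases i with i | i <;> rfl
    rw [hmap, fromRows_mul]
    refine hqg.fromRows ?_
    have : ((T (-N) : R[T;T⁻¹]) • (1 - p * q)).map polyLoop * g =
        r + (polyLoop (T M : R[T;T⁻¹]) • g) * s * (polyLoop (T M : R[T;T⁻¹]) • g) -
          polyLoop (T (M + N : ℕ) : R[T;T⁻¹]) • (r * s * (polyLoop (T M : R[T;T⁻¹]) • g)) := by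
      have hzx : polyLoop (T (-N) : R[T;T⁻¹]) * polyLoop (T N : R[T;T⁻¹]) = 1 := by
        rw [← map_mul, ← T_add, neg_add_cancel, T_zero, map_one]
      have hpq : (1 - p * q).map polyLoop = 1 - p.map polyLoop * q.map polyLoop := by
        simpa using map_sub (polyLoop (R := R)).mapMatrix 1 (p * q)
      have h1 : polyLoop (T (2 * M + N : ℕ) : R[T;T⁻¹]) = polyLoop (T M : R[T;T⁻¹]) *
          polyLoop (T M : R[T;T⁻¹]) * polyLoop (T N : R[T;T⁻¹]) := by
        rw [← map_mul, ← map_mul, ← T_add, ← T_add]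
        push_cast
        rw [two_mul]
      have h2 : polyLoop (T (M + N : ℕ) : R[T;T⁻¹]) = polyLoop (T M : R[T;T⁻¹]) *
          polyLoop (T N : R[T;T⁻¹]) := by
        rw [← map_mul, ← T_add, Nat.cast_add]
      rw [hsmul, hpq, hp', hq', h1, h2]
      exact smul_one_sub_mul_mul_eq hhg hzx
    rw [this]
    exact (hr.add ((hM.mul hs).mul hM)).sub (((hr.mul hs).mul hM).T_smul _)
  · have hmap : (fromCols p ((T N : R[T;T⁻¹]) • (1 : Matrix n n R[T;T⁻¹]))).map polyLoop =
        fromCols (p.map polyLoop) (polyLoop (T N : R[T;T⁻¹]) • 1) := by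
      rw [← Matrix.map_one polyLoop (map_zero _) (map_one _), ← hsmul]
      ext1 i j
      rcases j with j | j <;> rfl
    rw [hmap, mul_fromCols]
    refine IsPositive.fromCols ?_ ?_
    · have : h * p.map polyLoop = 1 - (polyLoop (T N : R[T;T⁻¹]) • h) * r := by
        rw [hp', mul_sub, hhg, mul_smul_comm, smul_mul_assoc]
      rw [this]
      exact IsPositive.one.sub (hN.mul hr)
    · rwa [mul_smul_comm, mul_one]

theorem Matrix.exists_isPositive_of_locally {g h : Matrix n n R⸨X⸩} (hhg : h * g = 1)
    (hlocal : ∀ I : Ideal R, I.IsMaximal → ∃ d ∉ I, ∃ α β : Matrix n n R[T;T⁻¹],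
      α * β = C d • (1 : Matrix n n R[T;T⁻¹]) ∧ β * α = C d • (1 : Matrix n n R[T;T⁻¹]) ∧
      (β.map polyLoop * g).IsPositive ∧ (h * α.map polyLoop).IsPositive) :
    ∃ a b : Matrix n n R[T;T⁻¹], a * b = 1 ∧ (b.map polyLoop * g).IsPositive ∧
      (h * a.map polyLoop).IsPositive := by
  have hgh : g * h = 1 := mul_eq_one_comm.mp hhg
  obtain ⟨S, Q, hQS, hS, hQ⟩ := exists_left_inverse_isPositive hhg
  have key {k l : Type _} {A : Matrix k n R⸨X⸩} {B : Matrix n l R⸨X⸩} (hA : (A * g).IsPositive)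
      (hB : (h * B).IsPositive) : (A * B).IsPositive := by
    have h1 : A * B = A * g * (h * B) := by
      rw [Matrix.mul_assoc, ← Matrix.mul_assoc g, hgh, Matrix.one_mul]
    rw [h1]
    exact hA.mul hB
  obtain ⟨e, he⟩ := IsPositive.exists_toLaurent (P := S * Q) (by
    rw [Matrix.map_mul]; exact key hS hQ)
  obtain ⟨σ, τ, h1⟩ := exists_factorization_of_isConj hQS he
    (isConj_of_idempotent_factorization hQS he fun I hI => by
      obtain ⟨d, hd, α, β, hαβ, hβα, hβ, hα⟩ := hlocal I hI
      obtain ⟨U, hU⟩ := IsPositive.exists_toLaurent (P := S * α) (by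
        rw [Matrix.map_mul]; exact key hS hα)
      obtain ⟨U', hU'⟩ := IsPositive.exists_toLaurent (P := β * Q) (by
        rw [Matrix.map_mul]; exact key hβ hQ)
      exact ⟨d, hd, α, β, hαβ, hβα, U, U', hU, hU'⟩)
  refine ⟨_, _, h1, ?_, ?_⟩
  · rw [Matrix.map_mul, Matrix.mul_assoc]
    exact (IsPositive.map_polyLoop τ).mul hS
  · rw [Matrix.map_mul, ← Matrix.mul_assoc]
    exact hQ.mul (IsPositive.map_polyLoop σ)
end

section
open Matrix LaurentPolynomial LaurentSeries
variable {R n : Type*} [CommRing R] [Fintype n] [DecidableEq n]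

theorem Matrix.det_diagonal_mulSingle (i : n) (u : R) :
    (diagonal (Pi.mulSingle i u)).det = u := by
  simp [det_diagonal]

omit [Fintype n] in
theorem Matrix.map_diagonal_mulSingle {R' : Type*} [CommRing R'] (f : R →+* R') (i : n) (u : R) :
    (diagonal (Pi.mulSingle i u)).map f = diagonal (Pi.mulSingle i (f u)) := by
  rw [diagonal_map (map_zero f)]
  congr 1
  ext j
  rcases eq_or_ne j i with rfl | hj <;> simp [*]

theorem Matrix.diagonal_mulSingle_mul (i : n) (u v : R) :
    diagonal (Pi.mulSingle i u) * diagonal (Pi.mulSingle i v) =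
      diagonal (Pi.mulSingle i (u * v)) := by
  rw [diagonal_mul_diagonal]
  congr 1
  ext j
  rcases eq_or_ne j i with rfl | hj <;> simp [*]

theorem Matrix.SpecialLinearGroup.exists_eq_polyLoop_mul_posLoop_of_isPositive [Nonempty n]
    (g : SpecialLinearGroup n R⸨X⸩) {a b : Matrix n n R[T;T⁻¹]} (hab : a * b = 1)
    (hb : (b.map polyLoop * (g : Matrix n n R⸨X⸩)).IsPositive)
    (ha : (((g⁻¹ : SpecialLinearGroup n R⸨X⸩) : Matrix n n R⸨X⸩) * a.map polyLoop).IsPositive) :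
    ∃ (p : SpecialLinearGroup n R[T;T⁻¹]) (q : SpecialLinearGroup n (PowerSeries R)),
      g = map polyLoop p * map posLoop q := by
  obtain ⟨V, hV⟩ := hb
  obtain ⟨V', hV'⟩ := ha
  obtain ⟨i⟩ := ‹Nonempty n›
  have hdab : a.det * b.det = 1 := by rw [← det_mul, hab, det_one]
  have hdV : posLoop V.det = polyLoop b.det := by
    rw [RingHom.map_det, RingHom.map_det, RingHom.mapMatrix_apply, RingHom.mapMatrix_apply, hV,
      det_mul, g.det_coe, mul_one]
  have hdV' : posLoop V'.det = polyLoop a.det := by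
    rw [RingHom.map_det, RingHom.map_det, RingHom.mapMatrix_apply, RingHom.mapMatrix_apply, hV',
      det_mul, (g⁻¹).det_coe, one_mul]
  have hdVV' : V'.det * V.det = 1 := by
    apply HahnSeries.ofPowerSeries_injective (Γ := ℤ)
    rw [map_mul, hdV, hdV', ← map_mul, hdab, map_one, map_one]
  refine ⟨⟨a * diagonal (Pi.mulSingle i b.det), ?_⟩,
    ⟨diagonal (Pi.mulSingle i V'.det) * V, ?_⟩, Subtype.ext ?_⟩
  · rw [det_mul, det_diagonal_mulSingle, hdab]
  · rw [det_mul, det_diagonal_mulSingle, hdVV']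
  · change (g : Matrix n n R⸨X⸩) = (a * diagonal (Pi.mulSingle i b.det)).map polyLoop *
      (diagonal (Pi.mulSingle i V'.det) * V).map posLoop
    rw [Matrix.map_mul, Matrix.map_mul, map_diagonal_mulSingle, map_diagonal_mulSingle, hdV', hV,
      Matrix.mul_assoc, ← Matrix.mul_assoc (diagonal _), diagonal_mulSingle_mul, ← map_mul,
      mul_comm b.det, hdab, map_one, Pi.mulSingle_one, diagonal_one', Matrix.one_mul,
      ← Matrix.mul_assoc, ← Matrix.map_mul, hab]
    simp
end

section
open Matrix LaurentPolynomial LaurentSeries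
variable {R n : Type*} [CommRing R] [Fintype n] [DecidableEq n]

theorem Matrix.SpecialLinearGroup.exists_eq_polyLoop_mul_posLoop (g : SpecialLinearGroup n R⸨X⸩) :
    ∃ (p : SpecialLinearGroup n R[T;T⁻¹]) (q : SpecialLinearGroup n (PowerSeries R)),
      g = map polyLoop p * map posLoop q := by
  rcases subsingleton_or_nontrivial n
  · exact ⟨1, 1, Subsingleton.elim _ _⟩
  obtain ⟨a, b, hab, hb, ha⟩ := Matrix.exists_isPositive_of_locally
    (g := (g : Matrix n n R⸨X⸩)) (h := (g⁻¹ : SpecialLinearGroup n R⸨X⸩))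
    (by rw [← coe_mul, inv_mul_cancel, coe_one])
    fun I _ => exists_isPositive_of_isMaximal I g
  exact g.exists_eq_polyLoop_mul_posLoop_of_isPositive hab hb ha
end

/-- `SL_n(A((t))) = SL_n(A[t, t⁻¹]) · SL_n(A⟦t⟧)`: every determinant-one matrix over the
Laurent series ring factors as a polynomial loop times a positive loop. -/
theorem SL_laurentSeries_factorization (A : Type*) [CommRing A] (n : ℕ)
    (g : Matrix.SpecialLinearGroup (Fin n)
      (Localization.Away (PowerSeries.X : PowerSeries A))) :
    ∃ (a : Matrix.SpecialLinearGroup (Fin n) (LaurentPolynomial A))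
      (b : Matrix.SpecialLinearGroup (Fin n) (PowerSeries A)),
      g = Matrix.SpecialLinearGroup.map (laurentInclusion A) a *
          Matrix.SpecialLinearGroup.map
            (algebraMap (PowerSeries A) (Localization.Away (PowerSeries.X : PowerSeries A)))
            b := by
  let e := localizationEquivLaurentSeries A
  let f : Localization.Away (PowerSeries.X : PowerSeries A) →+* LaurentSeries A := e
  obtain ⟨p, q, hpq⟩ := (Matrix.SpecialLinearGroup.map f g).exists_eq_polyLoop_mul_posLoop
  refine ⟨p, q, Subtype.ext (Matrix.map_injective e.injective ?_)⟩
  change (Matrix.SpecialLinearGroup.map f g).1 = (Matrix.SpecialLinearGroup.map f (_ * _)).1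
  rw [hpq, map_mul]
  congr 2
  ext i j
  exact congr(HahnSeries.coeff $((e.commutes (q.1 i j)).symm) _)
end
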